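/- arXiv:1412.0609 — 3 statements merged into one kernel-verified Lean document; each statement's English description precedes it below -/
import Mathlib

section
/- Let f and g be continuous, positive, non-increasing functions on [0,∞), let r ∈ ℕ, and assume φ_{r,0,f}(∞) < ∞. Then lim_{n→∞} φ_{r,n,f}(∞) > 0 if and only if liminf_{t→∞} f(t)/|P_r(t)| < ∞. -/
open Set Filter MeasureTheory
open scoped Topology

noncomputable section

/-- Weighted sup-norm `‖x‖_{C(S),w} = sup_{t ∈ S} |x t| / w t`. -/
def wNorm (x w : ℝ → ℝ) (S : Set ℝ) : ℝ :=
  sSup ((fun t => |x t| / w t) '' S)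

/-- Sup-norm `‖x‖_{C(S)} = sup_{t ∈ S} |x t|`. -/
def supNorm (x : ℝ → ℝ) (S : Set ℝ) : ℝ :=
  sSup ((fun t => |x t|) '' S)

/-- `G` is a perfect `g`-spline of order `r` on `[0,a]` with exactly `m` knots
`u 1 < ⋯ < u m` (where `u 0 = 0` and `u (m+1) = a`) and sign `ε ∈ {1,-1}`:
`G ∈ C^{r-1}[0,a]`, and on each open interval between consecutive knots `G` is
`r` times differentiable with `G^{(r)}(t) = ε·(-1)^i·g(t)` there. -/
def PerfectSplineWith (g : ℝ → ℝ) (r : ℕ) (a : ℝ) (m : ℕ) (u : ℕ → ℝ) (ε : ℝ)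
    (G : ℝ → ℝ) : Prop :=
  (ε = 1 ∨ ε = -1) ∧ u 0 = 0 ∧ u (m + 1) = a ∧ (∀ i ≤ m, u i < u (i + 1)) ∧
  ContDiffOn ℝ (r - 1 : ℕ) G (Icc 0 a) ∧
  ∀ i ≤ m, ContDiffOn ℝ (r : ℕ) G (Ioo (u i) (u (i + 1))) ∧
    ∀ s ∈ Ioo (u i) (u (i + 1)),
      iteratedDerivWithin r G (Ioo (u i) (u (i + 1))) s = ε * (-1 : ℝ) ^ i * g s

/-- `Γ^r_{n,g}[0,a]`: perfect `g`-splines of order `r` on `[0,a]` with at most `n` knots. -/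
def InGamma (g : ℝ → ℝ) (r n : ℕ) (a : ℝ) (G : ℝ → ℝ) : Prop :=
  ∃ m ≤ n, ∃ u : ℕ → ℝ, ∃ ε : ℝ, PerfectSplineWith g r a m u ε G

/-- `b 1 < ⋯ < b (n+r+1)` are `n+r+1` oscillation points of `G` on `[0,a]`
with respect to the weight `f`, as in (5). -/
def OscPointsAt (f : ℝ → ℝ) (r n : ℕ) (a : ℝ) (G : ℝ → ℝ) (b : ℕ → ℝ) : Prop :=
  0 ≤ b 1 ∧ b (n + r + 1) = a ∧ (∀ i, 1 ≤ i → i < n + r + 1 → b i < b (i + 1)) ∧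
  ∀ i, 1 ≤ i → i ≤ n + r + 1 →
    G (b i) = (-1 : ℝ) ^ (i + r + 1) * (wNorm G f (Icc 0 a) * f (b i))

/-- `G` has `n+r+1` oscillation points on `[0,a]`. -/
def HasOsc (f : ℝ → ℝ) (r n : ℕ) (a : ℝ) (G : ℝ → ℝ) : Prop :=
  ∃ b : ℕ → ℝ, OscPointsAt f r n a G b

/-- `G` is the extremal spline `G_{r,n,f,a}`: a member of `Γ^r_{n,g}[0,a]`
with `n+r+1` oscillation points. -/
def IsExtremalSpline (f g : ℝ → ℝ) (r n : ℕ) (a : ℝ) (G : ℝ → ℝ) : Prop :=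
  InGamma g r n a G ∧ HasOsc f r n a G

/-- Iterated antiderivatives: `g_0 = g`, `g_{k+1}(t) = ∫_0^t g_k`. -/
def gk (g : ℝ → ℝ) : ℕ → ℝ → ℝ
  | 0 => g
  | k + 1 => fun t => ∫ s in (0:ℝ)..t, gk g k s

/-- The constants `A_k` of the paper:
`A_0 = ∫_0^∞ g`, and
`A_k = ∫_0^∞ [ Σ_{s=0}^{k-1} (-1)^{k-s-1} A_s t^{k-s-1}/(k-s-1)! + (-1)^k g_k(t) ] dt`. -/
def Acoef (g : ℝ → ℝ) : ℕ → ℝ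
  | 0 => ∫ t in Ioi (0 : ℝ), g t
  | k + 1 => ∫ t in Ioi (0 : ℝ),
      ((∑ s : Fin (k + 1), (-1 : ℝ) ^ (k - s.1) * Acoef g s.1 * t ^ (k - s.1) /
        (Nat.factorial (k - s.1) : ℝ)) + (-1 : ℝ) ^ (k + 1) * gk g (k + 1) t)

/-- `P_k(t) = Σ_{s=0}^{k-1} (-1)^{k-s-1} A_s t^{k-s-1}/(k-s-1)! + (-1)^k g_k(t)`. -/
def Pfun (g : ℝ → ℝ) (k : ℕ) (t : ℝ) : ℝ :=
  (∑ s : Fin k, (-1 : ℝ) ^ (k - 1 - s.1) * Acoef g s.1 * t ^ (k - 1 - s.1) /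
    (Nat.factorial (k - 1 - s.1) : ℝ)) + (-1 : ℝ) ^ k * gk g k t

/-- Conditions (6): `A_0 < ∞` and `A_k < ∞` for `k = 1, …, r-1`,
expressed as integrability of the corresponding integrands over `(0,∞)`. -/
def Cond6 (g : ℝ → ℝ) (r : ℕ) : Prop :=
  IntegrableOn g (Ioi 0) ∧ ∀ k, 1 ≤ k → k ≤ r - 1 → IntegrableOn (Pfun g k) (Ioi 0)

/-- Membership in the class `W^r_{f,g}(ℝ₊)`: `x ∈ C[0,∞)` with
`‖x‖_{C[0,∞),f} < ∞`, `x ∈ C^{r-1}[0,∞)`, `x^{(r-1)}` locally absolutely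
continuous with `|x^{(r)}| ≤ g` a.e., the latter encoded by the increment bound
`|x^{(r-1)}(t) - x^{(r-1)}(s)| ≤ ∫_s^t g`. -/
def MemW (f g : ℝ → ℝ) (r : ℕ) (x : ℝ → ℝ) : Prop :=
  ContinuousOn x (Ici 0) ∧
  ContDiffOn ℝ (r - 1 : ℕ) x (Ici 0) ∧
  BddAbove ((fun t => |x t| / f t) '' Ici 0) ∧
  ∀ s t : ℝ, 0 ≤ s → s ≤ t →
    |iteratedDerivWithin (r - 1) x (Ici 0) t - iteratedDerivWithin (r - 1) x (Ici 0) s| ≤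
      ∫ u in s..t, g u

/-- The modulus of continuity `ω(D^k, δ)` of the `k`-th differentiation operator on
`W^r_{f,g}(ℝ₊)`. -/
def omegaD (f g : ℝ → ℝ) (r k : ℕ) (δ : ℝ) : ℝ :=
  sSup {y | ∃ x : ℝ → ℝ, MemW f g r x ∧ wNorm x f (Ici 0) ≤ δ ∧
    y = supNorm (iteratedDerivWithin k x (Ici 0)) (Ici 0)}

/-- A perfect `g`-spline of order `r` on `[0,∞)` with exactly `n` knots
`u 1 < ⋯ < u n` (and `u 0 = 0`), sign `ε`. -/
def PerfectSplineInf (g : ℝ → ℝ) (r n : ℕ) (u : ℕ → ℝ) (ε : ℝ) (Q : ℝ → ℝ) : Prop :=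
  (ε = 1 ∨ ε = -1) ∧ u 0 = 0 ∧ (∀ i < n, u i < u (i + 1)) ∧
  ContDiffOn ℝ (r - 1 : ℕ) Q (Ici 0) ∧
  (∀ i < n, ContDiffOn ℝ (r : ℕ) Q (Ioo (u i) (u (i + 1))) ∧
    ∀ s ∈ Ioo (u i) (u (i + 1)),
      iteratedDerivWithin r Q (Ioo (u i) (u (i + 1))) s = ε * (-1 : ℝ) ^ i * g s) ∧
  ContDiffOn ℝ (r : ℕ) Q (Ioi (u n)) ∧
  ∀ s ∈ Ioi (u n), iteratedDerivWithin r Q (Ioi (u n)) s = ε * (-1 : ℝ) ^ n * g s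

end


theorem gk_contOn {g : ℝ → ℝ} (hg : ContinuousOn g (Ici 0)) (k : ℕ) :
    ContinuousOn (gk g k) (Ici 0) := by
  induction k with
  | zero => exact hg
  | succ k ih =>
    have h1 : ∀ b : ℝ, 0 ≤ b → ContinuousOn (gk g (k+1)) (Icc 0 b) := by
      intro b hb
      have h2 : IntegrableOn (gk g k) (uIcc 0 b) := by
        rw [uIcc_of_le hb]
        exact (ih.mono Icc_subset_Ici_self).integrableOn_Icc
      have := intervalIntegral.continuousOn_primitive_interval h2
      rw [uIcc_of_le hb] at this
      exact this
    intro t ht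
    have ht : (0:ℝ) ≤ t := ht
    have := h1 (t+1) (by linarith) t ⟨ht, by linarith⟩
    refine this.mono_of_mem_nhdsWithin ?_
    have : Iio (t+1) ∈ 𝓝 t := Iio_mem_nhds (by linarith)
    filter_upwards [self_mem_nhdsWithin, mem_nhdsWithin_of_mem_nhds this] with x hx hx2
    exact ⟨hx, le_of_lt hx2⟩

theorem gk_intervalIntegrable {g : ℝ → ℝ} (hg : ContinuousOn g (Ici 0)) (k : ℕ) {a b : ℝ}
    (ha : 0 ≤ a) (hb : 0 ≤ b) : IntervalIntegrable (gk g k) volume a b := by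
  apply ContinuousOn.intervalIntegrable
  apply (gk_contOn hg k).mono
  intro x hx
  exact le_trans (le_min ha hb) hx.1

theorem gk_hasDerivAt {g : ℝ → ℝ} (hg : ContinuousOn g (Ici 0)) (k : ℕ) {t : ℝ} (ht : 0 < t) :
    HasDerivAt (gk g (k+1)) (gk g k t) t := by
  have hc : ContinuousAt (gk g k) t := (gk_contOn hg k).continuousAt (Ici_mem_nhds ht)
  apply intervalIntegral.integral_hasDerivAt_right (gk_intervalIntegrable hg k le_rfl ht.le) _ hc
  exact ContinuousOn.stronglyMeasurableAtFilter isOpen_Ioi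
    ((gk_contOn hg k).mono Ioi_subset_Ici_self) t ht

noncomputable def Ppoly (g : ℝ → ℝ) (k : ℕ) : Polynomial ℝ :=
  ∑ s : Fin k, Polynomial.C ((-1 : ℝ) ^ (k - 1 - s.1) * Acoef g s.1 /
    (Nat.factorial (k - 1 - s.1) : ℝ)) * Polynomial.X ^ (k - 1 - s.1)

theorem Pfun_eq (g : ℝ → ℝ) (k : ℕ) (t : ℝ) :
    Pfun g k t = (Ppoly g k).eval t + (-1) ^ k * gk g k t := by
  unfold Pfun Ppoly
  rw [Polynomial.eval_finsetSum]
  congr 1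
  apply Finset.sum_congr rfl
  intro s _
  simp
  ring

theorem Ppoly_degree (g : ℝ → ℝ) (k : ℕ) : (Ppoly g k).degree < (k : ℕ) := by
  unfold Ppoly
  rw [← Polynomial.mem_degreeLT]
  apply Submodule.sum_mem
  intro s _
  rw [Polynomial.mem_degreeLT]
  refine lt_of_le_of_lt (Polynomial.degree_C_mul_X_pow_le _ _) ?_
  have := s.2
  exact_mod_cast (by omega : k - 1 - s.1 < k)

theorem Ppoly_derivative (g : ℝ → ℝ) (k : ℕ) :
    Polynomial.derivative (Ppoly g (k+1)) = - Ppoly g k := by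
  unfold Ppoly
  rw [Fin.sum_univ_castSucc, Polynomial.derivative_add, Polynomial.derivative_sum,
    ← Finset.sum_neg_distrib]
  have : Polynomial.derivative (Polynomial.C ((-1 : ℝ) ^ (k + 1 - 1 - (Fin.last k).1) *
    Acoef g (Fin.last k).1 / (Nat.factorial (k + 1 - 1 - (Fin.last k).1) : ℝ)) *
    Polynomial.X ^ (k + 1 - 1 - (Fin.last k).1)) = 0 := by simp
  rw [this, add_zero]
  apply Finset.sum_congr rfl
  intro s _
  obtain ⟨j, hj⟩ : ∃ j, k = s.1 + j + 1 := ⟨k - s.1 - 1, by have := s.2; omega⟩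
  have e1 : k + 1 - 1 - (Fin.castSucc s).1 = j + 1 := by simp; omega
  have e2 : k - 1 - s.1 = j := by omega
  rw [e1, e2, Polynomial.derivative_C_mul_X_pow, ← neg_mul, ← Polynomial.C_neg]
  have hj0 : ((j:ℝ)+1) ≠ 0 := by positivity
  have hj1 : (Nat.factorial j : ℝ) ≠ 0 := by positivity
  congr 2
  simp [Nat.factorial_succ, pow_succ]
  field_simp

theorem Pfun_contOn {g : ℝ → ℝ} (hg : ContinuousOn g (Ici 0)) (k : ℕ) :
    ContinuousOn (Pfun g k) (Ici 0) := by
  have : Pfun g k = fun t => (Ppoly g k).eval t + (-1) ^ k * gk g k t := by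
    ext t; exact Pfun_eq g k t
  rw [this]
  exact (Polynomial.continuous _).continuousOn.add (continuousOn_const.mul (gk_contOn hg k))

theorem Pfun_hasDerivAt {g : ℝ → ℝ} (hg : ContinuousOn g (Ici 0)) (k : ℕ) {t : ℝ} (ht : 0 < t) :
    HasDerivAt (Pfun g (k+1)) (-(Pfun g k t)) t := by
  have : Pfun g (k+1) = fun t => (Ppoly g (k+1)).eval t + (-1) ^ (k+1) * gk g (k+1) t := by
    ext t; exact Pfun_eq g _ t
  rw [this, Pfun_eq]
  have h := ((Ppoly g (k+1)).hasDerivAt t).add ((gk_hasDerivAt hg k ht).const_mul ((-1)^(k+1)))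
  rw [Ppoly_derivative] at h
  refine HasDerivAt.congr_deriv h ?_
  rw [Polynomial.eval_neg, pow_succ]
  ring

theorem Pfun_zero (g : ℝ → ℝ) : Pfun g 0 = g := by
  ext t; simp [Pfun, gk]

theorem Pfun_succ_at_zero (g : ℝ → ℝ) (k : ℕ) : Pfun g (k+1) 0 = Acoef g k := by
  unfold Pfun
  rw [Fin.sum_univ_castSucc]
  have h1 : ∑ i : Fin k, (-1 : ℝ) ^ (k + 1 - 1 - (Fin.castSucc i).1) * Acoef g (Fin.castSucc i).1 *
      (0:ℝ) ^ (k + 1 - 1 - (Fin.castSucc i).1) /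
      (Nat.factorial (k + 1 - 1 - (Fin.castSucc i).1) : ℝ) = 0 := by
    apply Finset.sum_eq_zero
    intro i _
    have : k + 1 - 1 - (Fin.castSucc i).1 ≠ 0 := by have := i.2; simp; omega
    rw [zero_pow this]; simp
  rw [h1]
  simp [gk]

theorem Acoef_eq (g : ℝ → ℝ) (k : ℕ) : Acoef g k = ∫ t in Ioi (0:ℝ), Pfun g k t := by
  cases k with
  | zero => rw [Acoef, Pfun_zero]
  | succ k => rw [Acoef]; rfl

theorem as_sum_deg (p : Polynomial ℝ) (n : ℕ) (hp : p.degree < n) :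
    p = ∑ i ∈ Finset.range n, Polynomial.monomial i (p.coeff i) := by
  by_cases h : p = 0
  · subst h; simp
  · exact p.as_sum_range' n ((Polynomial.natDegree_lt_iff_degree_lt h).2 hp)

theorem exists_antideriv (p : Polynomial ℝ) (n : ℕ) (hp : p.degree < n) :
    ∃ q : Polynomial ℝ, Polynomial.derivative q = p ∧ q.degree < (n+1 : ℕ) := by
  refine ⟨∑ i ∈ Finset.range n, Polynomial.C (p.coeff i / (i+1)) * Polynomial.X ^ (i+1), ?_, ?_⟩
  · rw [Polynomial.derivative_sum]
    conv_rhs => rw [as_sum_deg p n hp]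
    apply Finset.sum_congr rfl
    intro i _
    rw [Polynomial.derivative_C_mul_X_pow, ← Polynomial.C_mul_X_pow_eq_monomial]
    congr 2
    have : (i:ℝ)+1 ≠ 0 := by positivity
    simp; field_simp
  · rw [← Polynomial.mem_degreeLT]
    apply Submodule.sum_mem
    intro s hs
    rw [Polynomial.mem_degreeLT]
    refine lt_of_le_of_lt (Polynomial.degree_C_mul_X_pow_le _ _) ?_
    have := Finset.mem_range.1 hs
    exact_mod_cast (by omega : s + 1 < n + 1)

theorem poly_rep {g : ℝ → ℝ} (hg : ContinuousOn g (Ici 0)) (σ α β : ℝ) (hα : 0 ≤ α) (hαβ : α < β)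
    (r : ℕ) : ∀ G : ℝ → ℝ, ContDiffOn ℝ (r : ℕ) G (Ioo α β) →
    (∀ s ∈ Ioo α β, iteratedDerivWithin r G (Ioo α β) s = σ * g s) →
    ∃ p : Polynomial ℝ, p.degree < (r : ℕ) ∧ ∀ s ∈ Ioo α β, G s = σ * gk g r s + p.eval s := by
  induction r with
  | zero =>
    intro G _ h
    refine ⟨0, by simp, fun s hs => ?_⟩
    have := h s hs
    rw [iteratedDerivWithin_zero] at this
    simpa [gk] using this
  | succ r ih =>
    intro G hG h
    have hu : UniqueDiffOn ℝ (Ioo α β) := isOpen_Ioo.uniqueDiffOn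
    have hG' : ContDiffOn ℝ (r : ℕ) (derivWithin G (Ioo α β)) (Ioo α β) :=
      hG.derivWithin hu (by exact_mod_cast le_rfl)
    obtain ⟨p, hp, hpe⟩ := ih _ hG' (fun s hs => by
      rw [← h s hs, iteratedDerivWithin_succ'])
    obtain ⟨q, hq, hqd⟩ := exists_antideriv p r hp
    have hder : ∀ s ∈ Ioo α β, HasDerivAt (fun t => G t - (σ * gk g (r+1) t + q.eval t)) 0 s := by
      intro s hs
      have h1 : HasDerivAt G (derivWithin G (Ioo α β) s) s := by
        have := (hG.differentiableOn (by simp) s hs).hasDerivWithinAt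
        exact this.hasDerivAt (isOpen_Ioo.mem_nhds hs)
      have h2 := h1.sub (((gk_hasDerivAt hg r (lt_of_le_of_lt hα hs.1)).const_mul σ).add
        (q.hasDerivAt s))
      refine HasDerivAt.congr_deriv h2 ?_
      rw [hpe s hs, hq]; ring
    obtain ⟨m, hm⟩ : ∃ m, m ∈ Ioo α β := ⟨(α+β)/2, by constructor <;> linarith⟩
    set c := G m - (σ * gk g (r+1) m + q.eval m) with hc
    refine ⟨q + Polynomial.C c, ?_, ?_⟩
    · refine lt_of_le_of_lt (Polynomial.degree_add_le _ _) (max_lt hqd ?_)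
      refine lt_of_le_of_lt Polynomial.degree_C_le ?_
      exact_mod_cast Nat.succ_pos r
    · intro s hs
      have := isOpen_Ioo.is_const_of_deriv_eq_zero (convex_Ioo α β).isPreconnected
        (fun x hx => (hder x hx).differentiableAt.differentiableWithinAt)
        (fun x hx => (hder x hx).deriv) hs hm
      simp only [Polynomial.eval_add, Polynomial.eval_C]
      rw [hc]
      linarith

theorem lagrange_formula (p : Polynomial ℝ) (r : ℕ) (hp : p.degree < (r : ℕ)) (v : ℕ → ℝ)
    (hv : Function.Injective v) (t : ℝ) :
    p.eval t = ∑ i ∈ Finset.range r, p.eval (v i) *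
      (Lagrange.basis (Finset.range r) v i).eval t := by
  have h := Lagrange.eq_interpolate (s := Finset.range r) (v := v) (f := p) hv.injOn (by simpa using hp)
  conv_lhs => rw [h]
  simp [Lagrange.interpolate_apply, Polynomial.eval_finsetSum]

theorem poly_flat (r : ℕ) (T t0 S M δ : ℝ) (hδ : 0 < δ) :
    ∃ T', T < T' ∧ S < T' ∧ t0 < T' ∧ ∀ p : Polynomial ℝ, p.degree < (r : ℕ) →
      (∀ x ∈ Ioo T T', |p.eval x| ≤ M) → |p.eval t0 - p.eval S| ≤ δ := by
  let v : ℝ → ℕ → ℝ := fun H i => T + (i+1) * H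
  let B : ℝ → ℕ → ℝ → ℝ := fun H i t => (Lagrange.basis (Finset.range r) (v H) i).eval t
  have hB : ∀ t i, i ∈ Finset.range r → Tendsto (fun H => B H i t) atTop
      (𝓝 (∏ j ∈ (Finset.range r).erase i, (((i:ℝ) - j)⁻¹ * (0 - (j+1))))) := by
    intro t i hi
    have : ∀ᶠ H in atTop, ∏ j ∈ (Finset.range r).erase i, (((i:ℝ) - j)⁻¹ * ((t - T) / H - (j+1)))
        = B H i t := by
      filter_upwards [eventually_gt_atTop 0] with H hH
      simp only [B, Lagrange.basis, Polynomial.eval_prod]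
      apply Finset.prod_congr rfl
      intro j hj
      have hne : (i:ℝ) - j ≠ 0 := by
        rw [sub_ne_zero]; exact_mod_cast (Finset.ne_of_mem_erase hj).symm
      simp only [Lagrange.basisDivisor, v, Polynomial.eval_mul, Polynomial.eval_C,
        Polynomial.eval_sub, Polynomial.eval_X]
      have : T + ((i:ℝ)+1) * H - (T + (j+1) * H) = (i - j) * H := by ring
      rw [this]
      field_simp
      ring
    refine Tendsto.congr' this ?_
    apply tendsto_finsetProd
    intro j _
    refine Tendsto.const_mul _ (Tendsto.sub_const ?_ _)
    exact tendsto_const_nhds.div_atTop tendsto_id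
  have hlim : Tendsto (fun H => ∑ i ∈ Finset.range r, M * |B H i t0 - B H i S|) atTop (𝓝 0) := by
    have : (0:ℝ) = ∑ i ∈ Finset.range r, M * |∏ j ∈ (Finset.range r).erase i, (((i:ℝ) - j)⁻¹ * (0 - (j+1)))
      - ∏ j ∈ (Finset.range r).erase i, (((i:ℝ) - j)⁻¹ * (0 - (j+1)))| := by simp
    rw [this]
    apply tendsto_finsetSum
    intro i hi
    exact (((hB t0 i hi).sub (hB S i hi)).abs).const_mul M
  obtain ⟨H, h1, h2, h3, h4⟩ := ((hlim.eventually (gt_mem_nhds hδ)).and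
    ((eventually_gt_atTop 0).and ((eventually_gt_atTop (S - T)).and
      (eventually_gt_atTop (t0 - T))))).exists
  have hr0 : (0:ℝ) ≤ r := Nat.cast_nonneg r
  refine ⟨T + (r+1) * H, by nlinarith, by nlinarith, by nlinarith, ?_⟩
  intro p hp hb
  have hinj : Function.Injective (v H) := by
    intro i j hij
    simp only [v] at hij
    have : (i:ℝ) = j := by
      have := mul_right_cancel₀ h2.ne' (add_left_cancel hij)
      linarith
    exact_mod_cast this
  rw [lagrange_formula p r hp (v H) hinj t0, lagrange_formula p r hp (v H) hinj S,
    ← Finset.sum_sub_distrib]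
  refine (Finset.abs_sum_le_sum_abs _ _).trans (le_trans (Finset.sum_le_sum ?_) h1.le)
  intro i hi
  rw [← mul_sub, abs_mul]
  apply mul_le_mul_of_nonneg_right _ (abs_nonneg _)
  apply hb
  have hir : (i:ℝ) + 1 ≤ r := by exact_mod_cast Finset.mem_range.1 hi
  have hi0 : (0:ℝ) ≤ i := Nat.cast_nonneg i
  simp only [v]
  constructor <;> nlinarith

theorem tend_of_deriv {h h' : ℝ → ℝ} (hd : ∀ t, 0 < t → HasDerivAt h (h' t) t) {c : ℝ} (hc : 0 < c)
    (he : ∀ᶠ t in atTop, c ≤ h' t) : Tendsto h atTop atTop := by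
  obtain ⟨T0, hT0⟩ := eventually_atTop.1 he
  set T := max T0 1 with hT
  have hT1 : 1 ≤ T := le_max_right _ _
  have hcont : ContinuousOn h (Ici T) := fun x hx =>
    (hd x (by have : T ≤ x := hx; linarith)).continuousAt.continuousWithinAt
  have key : ∀ t, T ≤ t → h T + c * (t - T) ≤ h t := by
    intro t ht
    have := (convex_Ici T).mul_sub_le_image_sub_of_le_deriv hcont
      (C := c) (fun x hx => by
        rw [interior_Ici] at hx
        have hx : T < x := hx
        exact (hd x (by linarith)).differentiableAt.differentiableWithinAt)
      (fun x hx => by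
        rw [interior_Ici] at hx
        have hx : T < x := hx
        rw [(hd x (by linarith)).deriv]
        exact hT0 x (le_trans (le_max_left _ _) hx.le)) T self_mem_Ici t ht ht
    linarith
  have h2 : Tendsto (fun t => h T + c * (t - T)) atTop atTop := by
    apply tendsto_atTop_add_const_left
    exact (tendsto_atTop_add_const_right _ (-T) tendsto_id).const_mul_atTop hc
  refine tendsto_atTop_mono' _ ?_ h2
  filter_upwards [eventually_ge_atTop T] with t ht using key t ht

theorem good_P {g : ℝ → ℝ} (hg : ContinuousOn g (Ici 0)) (hg_pos : ∀ t ∈ Ici (0:ℝ), 0 < g t)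
    (r : ℕ) (q : Polynomial ℝ) (hq : q.degree < (r : ℕ)) (M : ℝ)
    (hM : ∀ t, 0 < t → |gk g r t + q.eval t| ≤ M) (k : ℕ) :
    k ≤ r → (∀ t, 0 ≤ t → 0 < Pfun g k t) ∧ (1 ≤ k → Tendsto (Pfun g k) atTop (𝓝 0)) ∧
      (k < r → ∀ t, 0 < t →
        gk g k t + (Polynomial.derivative^[r-k] q).eval t = (-1)^k * Pfun g k t) := by
  let H : ℕ → ℝ → ℝ := fun k t => gk g k t + (Polynomial.derivative^[r-k] q).eval t
  have hHd : ∀ k, k + 1 ≤ r → ∀ t, 0 < t → HasDerivAt (H (k+1)) (H k t) t := by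
    intro k hk t ht
    have h := (gk_hasDerivAt hg k ht).add ((Polynomial.derivative^[r-(k+1)] q).hasDerivAt t)
    rw [← Function.iterate_succ_apply' (f := Polynomial.derivative),
      show (r - (k+1)).succ = r - k by omega] at h
    exact h
  have hHc : ∀ k, ContinuousOn (H k) (Ici 0) := fun k =>
    (gk_contOn hg k).add (Polynomial.continuous _).continuousOn
  have hHr : ∀ t, 0 < t → |H r t| ≤ M := by
    intro t ht
    have := hM t ht
    simpa [H] using this
  have hnot : ∀ e : ℝ, (e = 1 ∨ e = -1) → ¬ Tendsto (fun t => e * H r t) atTop atTop := by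
    intro e he h
    obtain ⟨t, h1, h2⟩ := ((h.eventually (eventually_gt_atTop M)).and (eventually_gt_atTop 0)).exists
    have h3 := abs_le.1 (hHr t h2)
    rcases he with rfl | rfl <;> linarith [h3.1, h3.2]
  have hB : ∀ e : ℝ, (e = 1 ∨ e = -1) → ∀ j, j < r → ∀ c, 0 < c →
      ¬ (∀ᶠ t in atTop, c ≤ e * H j t) := by
    intro e he j hj c hc hev
    have : ∀ d, j + 1 + d ≤ r → Tendsto (fun t => e * H (j+1+d) t) atTop atTop := by
      intro d
      induction d with
      | zero =>
        intro h
        exact tend_of_deriv (fun t ht => (hHd j h t ht).const_mul e) hc hev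
      | succ d ih =>
        intro h
        have h1 := ih (by omega)
        exact tend_of_deriv (fun t ht => (hHd (j+1+d) h t ht).const_mul e) one_pos
          (h1.eventually (eventually_ge_atTop 1))
    have h := this (r - (j+1)) (by omega)
    rw [show j + 1 + (r - (j+1)) = r by omega] at h
    exact hnot e he h
  induction k with
  | zero =>
    intro _
    refine ⟨?_, by simp, ?_⟩
    · intro t ht; rw [Pfun_zero]; exact hg_pos t ht
    · intro _ t _
      rw [Nat.sub_zero, Polynomial.iterate_derivative_eq_zero_of_degree_lt hq]
      simp [Pfun_zero, gk]
  | succ k ih =>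
    intro hk
    obtain ⟨hpos, -, heq⟩ := ih (by omega)
    have heq := heq (by omega)
    set e : ℝ := (-1)^k with he
    have he' : e = 1 ∨ e = -1 := neg_one_pow_eq_or ℝ k
    have hee : e * e = 1 := by rcases he' with h | h <;> rw [h] <;> norm_num
    let h : ℝ → ℝ := fun t => e * H (k+1) t
    have hhd : ∀ t, 0 < t → HasDerivAt h (Pfun g k t) t := by
      intro t ht
      refine HasDerivAt.congr_deriv ((hHd k hk t ht).const_mul e) ?_
      have : H k t = e * Pfun g k t := heq t ht
      rw [this, ← mul_assoc, hee, one_mul]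
    have hhc : ContinuousOn h (Ici 0) := continuousOn_const.mul (hHc _)
    have hmono : StrictMonoOn h (Ici 0) := by
      apply strictMonoOn_of_deriv_pos (convex_Ici 0) hhc
      intro x hx
      rw [interior_Ici] at hx
      rw [(hhd x hx).deriv]
      exact hpos x (le_of_lt hx)
    have hψ : Monotone (fun t => h (max t 0)) := by
      intro a b hab
      exact hmono.monotoneOn (mem_Ici.2 (le_max_right _ _)) (mem_Ici.2 (le_max_right _ _)) (max_le_max_right 0 hab)
    have hψe : (fun t => h (max t 0)) =ᶠ[atTop] h := by
      filter_upwards [eventually_ge_atTop 0] with t ht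
      simp [ht]
    have hnt : ¬ Tendsto h atTop atTop := by
      intro ht
      rcases Nat.lt_or_ge (k+1) r with h1 | h1
      · exact hB e he' (k+1) h1 1 one_pos (ht.eventually (eventually_ge_atTop 1))
      · have : k + 1 = r := by omega
        have h2 := hnot e he'
        rw [← this] at h2
        exact h2 ht
    obtain ⟨l, hl⟩ : ∃ l, Tendsto h atTop (𝓝 l) := by
      rcases tendsto_atTop_of_monotone hψ with h1 | ⟨l, h1⟩
      · exact absurd (h1.congr' hψe) hnt
      · exact ⟨l, h1.congr' hψe⟩
    have hint : ∫ t in Ioi (0:ℝ), Pfun g k t = l - h 0 :=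
      integral_Ioi_of_hasDerivAt_of_nonneg (hhc 0 self_mem_Ici) (fun x hx => hhd x hx)
        (fun x hx => (hpos x (le_of_lt hx)).le) hl
    rw [← Acoef_eq, ← Pfun_succ_at_zero] at hint
    have hconst : ∀ t, 0 ≤ t → Pfun g (k+1) t = l - h t := by
      intro t ht
      rcases ht.eq_or_lt with rfl | ht'
      · exact hint
      have hc2 : ContinuousOn (fun t => Pfun g (k+1) t + h t) (Icc 0 t) :=
        ((Pfun_contOn hg (k+1)).add hhc).mono Icc_subset_Ici_self
      obtain ⟨y, hy, hy2⟩ := exists_hasDerivAt_eq_slope (fun t => Pfun g (k+1) t + h t)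
        (fun _ => 0) ht' hc2 (fun x hx => by
          refine HasDerivAt.congr_deriv ((Pfun_hasDerivAt hg k hx.1).add (hhd x hx.1)) ?_
          ring)
      have h5 : (Pfun g (k+1) t + h t) - (Pfun g (k+1) 0 + h 0) = 0 := by
        rcases div_eq_zero_iff.1 hy2.symm with h6 | h6
        · exact h6
        · linarith
      linarith
    refine ⟨?_, ?_, ?_⟩
    · intro t ht
      rw [hconst t ht]
      have h1 : h t < h (t+1) := hmono ht (by show (0:ℝ) ≤ t + 1; linarith) (by linarith)
      have h2 : h (t+1) ≤ l := by
        refine ge_of_tendsto hl ?_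
        filter_upwards [eventually_ge_atTop (t+1)] with s hs
        exact hmono.monotoneOn (by show (0:ℝ) ≤ t + 1; linarith)
          (by show (0:ℝ) ≤ s; linarith) hs
      linarith
    · intro _
      have h1 : Tendsto (fun t => l - h t) atTop (𝓝 (l - l)) := hl.const_sub l
      rw [sub_self] at h1
      refine h1.congr' ?_
      filter_upwards [eventually_ge_atTop 0] with t ht
      exact (hconst t ht).symm
    · intro hkr t ht
      have hl0 : l = 0 := by
        rcases lt_trichotomy l 0 with h1 | h1 | h1
        · exfalso
          refine hB (-e) (by rcases he' with h | h <;> rw [h] <;> simp) (k+1) hkr (-l/2) (by linarith) ?_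
          filter_upwards [hl.eventually (gt_mem_nhds (show l < l/2 by linarith))] with s hs
          have : h s = e * H (k+1) s := rfl
          linarith
        · exact h1
        · exfalso
          refine hB e he' (k+1) hkr (l/2) (by linarith) ?_
          filter_upwards [hl.eventually (lt_mem_nhds (show l/2 < l by linarith))] with s hs
          exact hs.le
      have h1 := hconst t ht.le
      have h2 : h t = e * H (k+1) t := rfl
      have h3 : H (k+1) t = e * (e * H (k+1) t) := by rw [← mul_assoc, hee, one_mul]
      show H (k+1) t = _
      rw [h3, ← h2, h1, hl0, pow_succ, ← he]
      ring

theorem deg_C_mul (c : ℝ) (p : Polynomial ℝ) (n : ℕ) (hp : p.degree < (n : ℕ)) :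
    (Polynomial.C c * p).degree < (n : ℕ) := by
  rw [← Polynomial.mem_degreeLT] at hp ⊢
  rw [← Polynomial.smul_eq_C_mul]
  exact Submodule.smul_mem _ c hp

theorem wNorm_nonneg {f G : ℝ → ℝ} {a : ℝ} (hf_pos : ∀ t ∈ Ici (0:ℝ), 0 < f t) :
    0 ≤ wNorm G f (Icc 0 a) := by
  apply Real.sSup_nonneg
  rintro _ ⟨t, ht, rfl⟩
  exact div_nonneg (abs_nonneg _) (hf_pos t ht.1).le

theorem le_wNorm {f G : ℝ → ℝ} {a : ℝ} (hf_c : ContinuousOn f (Ici 0))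
    (hf_pos : ∀ t ∈ Ici (0:ℝ), 0 < f t) (hG : ContinuousOn G (Icc 0 a)) {t : ℝ}
    (ht : t ∈ Icc 0 a) : |G t| ≤ wNorm G f (Icc 0 a) * f t := by
  have hc : ContinuousOn (fun t => |G t| / f t) (Icc 0 a) :=
    hG.abs.div (hf_c.mono Icc_subset_Ici_self) (fun x hx => (hf_pos x hx.1).ne')
  have hb := (isCompact_Icc.image_of_continuousOn hc).bddAbove
  have := le_csSup hb (mem_image_of_mem _ ht)
  rwa [div_le_iff₀ (hf_pos t ht.1)] at this

theorem exists_bounded {f g : ℝ → ℝ}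
    (hf_c : ContinuousOn f (Ici 0)) (hf_pos : ∀ t ∈ Ici (0:ℝ), 0 < f t)
    (hf_anti : AntitoneOn f (Ici 0))
    (hg_c : ContinuousOn g (Ici 0)) 
    (r : ℕ) (C : ℝ)
    (hG : ∀ a, 0 < a → ∃ G : ℝ → ℝ, IsExtremalSpline f g r 0 a G ∧ wNorm G f (Icc 0 a) ≤ C) :
    ∃ q : Polynomial ℝ, q.degree < (r : ℕ) ∧ ∃ M, ∀ t, 0 < t → |gk g r t + q.eval t| ≤ M := by
  set M := C * f 0 with hMdef
  have h1 : ∀ N : ℕ, ∃ σ : ℝ, (σ = 1 ∨ σ = -1) ∧ ∃ p : Polynomial ℝ, p.degree < (r : ℕ) ∧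
      ∀ t ∈ Ioo (0:ℝ) (N + 1), |σ * gk g r t + p.eval t| ≤ M := by
    intro N
    have hN : (0:ℝ) < N + 1 := by positivity
    obtain ⟨G, ⟨⟨m, hm, u, ε, hε, hu0, hu1, -, hcd, hsp⟩, -⟩, hw⟩ := hG (N+1) hN
    have hm0 : m = 0 := by omega
    subst hm0
    have h := hsp 0 le_rfl
    rw [zero_add] at h hu1
    rw [hu0, hu1] at h
    obtain ⟨p, hp, hpe⟩ := poly_rep hg_c ε 0 (N+1) le_rfl hN r G h.1 (fun s hs => by
      rw [h.2 s hs]; simp)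
    refine ⟨ε, hε, p, hp, fun t ht => ?_⟩
    rw [← hpe t ht]
    refine (le_wNorm hf_c hf_pos hcd.continuousOn ⟨ht.1.le, ht.2.le⟩).trans ?_
    have h2 : f t ≤ f 0 := hf_anti self_mem_Ici ht.1.le ht.1.le
    have h3 : 0 < f t := hf_pos t ht.1.le
    have h4 := wNorm_nonneg (G := G) (a := (N+1:ℝ)) hf_pos
    exact mul_le_mul hw h2 h3.le (h4.trans hw)
  choose σ hσ p hp hb using h1
  let v : ℕ → ℝ := fun i => i + 1
  have hv : Function.Injective v := by
    intro i j hij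
    simp only [v] at hij
    exact_mod_cast add_right_cancel hij
  obtain ⟨B, hB⟩ : ∃ B, ∀ t ∈ Icc (0:ℝ) (r+1), |gk g r t| ≤ B := by
    have := isCompact_Icc.exists_bound_of_continuousOn (f := gk g r)
      ((gk_contOn hg_c r).mono (show Icc (0:ℝ) ((r:ℝ)+1) ⊆ Ici 0 from Icc_subset_Ici_self))
    simpa using this
  let y : ℕ → ℝ × (Fin r → ℝ) := fun N => (σ (N + r), fun i => (p (N + r)).eval (v i))
  have hM0 : 0 ≤ M := by
    have := hb 0 (1/2) ⟨by norm_num, by norm_num⟩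
    exact (abs_nonneg _).trans this
  have hB0 : 0 ≤ B := (abs_nonneg _).trans (hB 0 ⟨le_rfl, by positivity⟩)
  have hyb : ∀ N, y N ∈ Metric.closedBall (0 : ℝ × (Fin r → ℝ)) (1 + M + B) := by
    intro N
    rw [mem_closedBall_zero_iff, Prod.norm_def]
    have hs1 : |σ (N+r)| = 1 := by rcases hσ (N+r) with h | h <;> rw [h] <;> simp
    apply max_le
    · simp only [y, Real.norm_eq_abs, hs1]; linarith
    · rw [pi_norm_le_iff_of_nonneg (by linarith)]
      intro i
      simp only [y, Real.norm_eq_abs]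
      have hi : ((i:ℕ):ℝ) + 1 ≤ r := by exact_mod_cast i.2
      have hi0 : (0:ℝ) ≤ (i:ℕ) := by positivity
      have h2 := hb (N+r) (v i) ⟨by simp only [v]; linarith, by
        simp only [v]; push_cast; have : (0:ℝ) ≤ N := by positivity
        linarith⟩
      have h3 := hB (v i) ⟨by simp only [v]; linarith, by simp only [v]; linarith⟩
      have h4 : |σ (N+r) * gk g r (v i)| ≤ B := by rw [abs_mul, hs1, one_mul]; exact h3
      have h5 : (p (N+r)).eval (v i) = (σ (N+r) * gk g r (v i) + (p (N+r)).eval (v i))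
        - σ (N+r) * gk g r (v i) := by ring
      rw [h5]
      refine (abs_sub _ _).trans ?_
      linarith
  obtain ⟨⟨s, w⟩, -, ψ, hψ, hlim⟩ := tendsto_subseq_of_bounded Metric.isBounded_closedBall hyb
  have hlims : Tendsto (fun N => σ (ψ N + r)) atTop (𝓝 s) := by
    have := (continuous_fst.tendsto _).comp hlim
    exact this
  have hlimw : ∀ i : Fin r, Tendsto (fun N => (p (ψ N + r)).eval (v i)) atTop (𝓝 (w i)) := by
    intro i
    have := (((continuous_apply i).comp continuous_snd).tendsto _).comp hlim
    exact this
  have hss : s * s = 1 := by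
    have h2 := hlims.mul hlims
    have h3 : (fun N => σ (ψ N + r) * σ (ψ N + r)) = fun _ => (1:ℝ) := by
      ext N
      rcases hσ (ψ N + r) with h | h <;> rw [h] <;> norm_num
    rw [h3] at h2
    exact (tendsto_nhds_unique h2 tendsto_const_nhds)
  let w' : ℕ → ℝ := fun i => if h : i < r then w ⟨i, h⟩ else 0
  let P : Polynomial ℝ := Lagrange.interpolate (Finset.range r) v w'
  have hPd : P.degree < (r:ℕ) := by
    have := Lagrange.degree_interpolate_lt (s := Finset.range r) (v := v) w' hv.injOn
    rw [Finset.card_range] at this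
    exact this
  have hPl : ∀ t, Tendsto (fun N => (p (ψ N + r)).eval t) atTop (𝓝 (P.eval t)) := by
    intro t
    have h2 : (fun N => (p (ψ N + r)).eval t) = fun N => ∑ i ∈ Finset.range r,
        (p (ψ N + r)).eval (v i) * (Lagrange.basis (Finset.range r) v i).eval t := by
      ext N; exact lagrange_formula _ r (hp _) v hv t
    have h3 : P.eval t = ∑ i ∈ Finset.range r,
        w' i * (Lagrange.basis (Finset.range r) v i).eval t := by
      simp [P, Lagrange.interpolate_apply, Polynomial.eval_finsetSum]
    rw [h2, h3]
    apply tendsto_finsetSum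
    intro i hi
    have hi := Finset.mem_range.1 hi
    have := (hlimw ⟨i, hi⟩).mul_const ((Lagrange.basis (Finset.range r) v i).eval t)
    simpa [w', hi] using this
  have hfinal : ∀ t, 0 < t → |s * gk g r t + P.eval t| ≤ M := by
    intro t ht
    have h2 := ((hlims.mul_const (gk g r t)).add (hPl t)).abs
    refine le_of_tendsto h2 ?_
    filter_upwards [eventually_ge_atTop (⌈t⌉₊)] with N hN
    apply hb
    refine ⟨ht, ?_⟩
    have h3 : t ≤ N := (Nat.le_ceil t).trans (by exact_mod_cast hN)
    have h4 : (N:ℝ) ≤ ψ N := by exact_mod_cast hψ.id_le N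
    push_cast
    have : (0:ℝ) ≤ r := by positivity
    linarith
  refine ⟨Polynomial.C s * P, deg_C_mul s P r hPd, M, ?_⟩
  intro t ht
  have h2 := hfinal t ht
  have h3 : gk g r t + (Polynomial.C s * P).eval t = s * (s * gk g r t + P.eval t) := by
    simp only [Polynomial.eval_mul, Polynomial.eval_C]
    linear_combination (-(gk g r t)) * hss
  have h4 : |s| = 1 := by
    have : |s| * |s| = 1 := by rw [← abs_mul, hss, abs_one]
    nlinarith [abs_nonneg s]
  rw [h3, abs_mul, h4, one_mul]
  exact h2

theorem locate {m : ℕ} {u : ℕ → ℝ} {x : ℝ} (h0 : u 0 ≤ x) (h1 : x < u (m+1)) :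
    ∃ i ≤ m, u i ≤ x ∧ x < u (i+1) := by
  classical
  have hex : ∃ i, x < u (i+1) := ⟨m, h1⟩
  refine ⟨Nat.find hex, Nat.find_min' hex h1, ?_, Nat.find_spec hex⟩
  rcases Nat.eq_zero_or_pos (Nat.find hex) with h | h
  · rw [h]; exact h0
  · have := Nat.find_min hex (m := Nat.find hex - 1) (by omega)
    rw [Nat.sub_add_cancel h] at this
    exact not_lt.1 this

theorem spline_incr {g G : ℝ → ℝ} (hg_c : ContinuousOn g (Ici 0))
    (hg_pos : ∀ t ∈ Ici (0:ℝ), 0 < g t) {r m : ℕ} {a : ℝ} (ha : 0 < a) {u : ℕ → ℝ} {ε : ℝ}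
    (hG : PerfectSplineWith g (r+1) a m u ε G) {s t : ℝ} (hs : 0 ≤ s) (hst : s ≤ t) (ht : t ≤ a) :
    |iteratedDerivWithin r G (Icc 0 a) t - iteratedDerivWithin r G (Icc 0 a) s| ≤
      ∫ x in s..t, g x := by
  obtain ⟨hε, hu0, hu1, hum, hcd, hsp⟩ := hG
  set D := iteratedDerivWithin r G (Icc 0 a) with hD
  have hcont : ContinuousOn D (Icc 0 a) :=
    hcd.continuousOn_iteratedDerivWithin (by simp) (uniqueDiffOn_Icc ha)
  have humono : ∀ i j, i ≤ j → j ≤ m + 1 → u i ≤ u j := by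
    intro i j hij
    induction j, hij using Nat.le_induction with
    | base => intro _; exact le_rfl
    | succ j hij ih => intro hj; exact (ih (by omega)).trans (hum j (by omega)).le
  have hder : ∀ x ∈ Ioo s t \ range u, HasDerivAt D (deriv D x) x ∧ |deriv D x| ≤ g x := by
    intro x hx
    have hx0 : 0 < x := lt_of_le_of_lt hs hx.1.1
    have hxa : x < a := lt_of_lt_of_le hx.1.2 ht
    obtain ⟨i, hi, hxi, hxi2⟩ := locate (m := m) (u := u) (x := x) (by rw [hu0]; exact hx0.le)
      (by rw [hu1]; exact hxa)
    have hxi' : u i < x := lt_of_le_of_ne hxi (fun h => hx.2 ⟨i, h⟩)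
    have hmem : x ∈ Ioo (u i) (u (i+1)) := ⟨hxi', hxi2⟩
    obtain ⟨hc, hv⟩ := hsp i hi
    have h1 : DifferentiableOn ℝ (iteratedDerivWithin r G (Ioo (u i) (u (i+1))))
        (Ioo (u i) (u (i+1))) :=
      hc.differentiableOn_iteratedDerivWithin (by exact_mod_cast Nat.lt_succ_self r)
        isOpen_Ioo.uniqueDiffOn
    have h2 := hv x hmem
    rw [iteratedDerivWithin_succ] at h2
    have h3 : HasDerivAt (iteratedDerivWithin r G (Ioo (u i) (u (i+1))))
        (ε * (-1 : ℝ) ^ i * g x) x := by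
      rw [← h2]
      exact (h1 x hmem).hasDerivWithinAt.hasDerivAt (isOpen_Ioo.mem_nhds hmem)
    have h4 : HasDerivAt D (ε * (-1 : ℝ) ^ i * g x) x := by
      refine h3.congr_of_eventuallyEq ?_
      filter_upwards [isOpen_Ioo.mem_nhds hmem] with y hy
      have hy0 : 0 < y := by
        have := humono 0 i (by omega) (by omega)
        rw [hu0] at this
        exact lt_of_le_of_lt this hy.1
      have hya : y < a := by
        have := humono (i+1) (m+1) (by omega) le_rfl
        rw [hu1] at this
        exact lt_of_lt_of_le hy.2 this
      have hset : Icc 0 a =ᶠ[𝓝 y] Ioo (u i) (u (i+1)) := by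
        filter_upwards [isOpen_Ioo.mem_nhds hy, Icc_mem_nhds hy0 hya] with z hz hz2
        apply propext
        exact ⟨fun _ => hz, fun _ => hz2⟩
      rw [hD, iteratedDerivWithin, iteratedDerivWithin, iteratedFDerivWithin_congr_set hset]
    rw [h4.deriv]
    refine ⟨h4, ?_⟩
    have h5 : |ε * (-1:ℝ)^i| = 1 := by
      rw [abs_mul]
      rcases hε with h | h <;> simp [h]
    rw [abs_mul, h5, one_mul, abs_of_pos (hg_pos x hx0.le)]
  have hgi : IntervalIntegrable g volume s t := gk_intervalIntegrable hg_c 0 hs (hs.trans hst)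
  have hnull : ∀ᵐ x ∂volume, x ∉ range u :=
    (countable_range u).ae_notMem volume
  have hnull2 : ∀ᵐ x ∂volume, x ≠ t := by simp [ae_iff, measure_singleton]
  have hae : ∀ᵐ x ∂volume, x ∈ Ioc s t → ‖deriv D x‖ ≤ g x := by
    filter_upwards [hnull, hnull2] with x hx hx2 hx3
    exact (hder x ⟨⟨hx3.1, lt_of_le_of_ne hx3.2 hx2⟩, hx⟩).2
  have hDi : IntervalIntegrable (deriv D) volume s t := by
    refine hgi.mono_fun' (measurable_deriv D).aestronglyMeasurable ?_
    rw [uIoc_of_le hst, EventuallyLE, ae_restrict_iff' measurableSet_Ioc]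
    exact hae
  have := integral_eq_of_hasDerivAt_off_countable_of_le D (deriv D) hst (countable_range u)
    (hcont.mono (Icc_subset_Icc hs ht)) (fun x hx => (hder x hx).1) hDi
  rw [← this]
  exact intervalIntegral.norm_integral_le_of_norm_le hst hae hgi

theorem chain {a α β : ℝ} (ha : 0 < a) (hα : 0 ≤ α) (hβ : β ≤ a) (Q : ℕ → ℝ → ℝ) (R : ℕ)
    (hQc : ∀ k, ContinuousOn (Q k) (Icc α β))
    (hQ : ∀ k < R, ∀ s t, α ≤ s → s ≤ t → t ≤ β → ∫ x in s..t, Q k x ≤ Q (k+1) s)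
    (m : ℕ) : m + 1 ≤ R → ∀ (x : ℝ → ℝ) (e : ℝ) (z : ℕ → ℝ), ContDiffOn ℝ (m : ℕ) x (Icc 0 a) →
    (∀ s t, α ≤ s → s ≤ t → t ≤ β →
      |iteratedDerivWithin m x (Icc 0 a) t - iteratedDerivWithin m x (Icc 0 a) s| ≤ Q 1 s) →
    (∀ i ≤ m, z i < z (i+1)) → α ≤ z 0 → z (m+1) ≤ β →
    (∀ i ≤ m + 1, 0 < e * (-1)^i * x (z i)) →
    ∀ t, α ≤ t → t ≤ z 0 → |x t| ≤ Q (m+1) t := by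
  induction m with
  | zero =>
    intro hR x e z hx hinc hz hz0 hz1 hs t ht1 ht2
    have hz01 := hz 0 le_rfl
    have hc : ContinuousOn (fun t => e * x t) (Icc (z 0) (z 1)) :=
      continuousOn_const.mul (hx.continuousOn.mono (Icc_subset_Icc (by linarith) (by linarith)))
    have h0 := hs 0 (by omega)
    have h1 := hs 1 (by omega)
    obtain ⟨ξ, hξ, hξ0⟩ := intermediate_value_Icc' hz01.le hc
      (show (0:ℝ) ∈ Icc (e * x (z 1)) (e * x (z 0)) by constructor <;> simp at h0 h1 <;> linarith)
    have he : e ≠ 0 := by rintro rfl; simp at h0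
    have hx0 : x ξ = 0 := by simpa [he] using hξ0
    have := hinc t ξ ht1 (by linarith [hξ.1]) (by linarith [hξ.2])
    simpa [iteratedDerivWithin_zero, hx0] using this
  | succ m ih =>
    intro hR x e z hx hinc hz hz0 hz1 hs t ht1 ht2
    have hu := uniqueDiffOn_Icc ha
    have hzm : ∀ i j, i ≤ j → j ≤ m + 2 → z i ≤ z j := by
      intro i j hij
      induction j, hij using Nat.le_induction with
      | base => intro _; exact le_rfl
      | succ j hij ih => intro hj; exact (ih (by omega)).trans (hz j (by omega)).le
    have hzα : ∀ i ≤ m+2, α ≤ z i := fun i hi => hz0.trans (hzm 0 i (by omega) hi)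
    have hzβ : ∀ i ≤ m+2, z i ≤ β := fun i hi => (hzm i (m+2) hi le_rfl).trans hz1
    have he : e ≠ 0 := by rintro rfl; have := hs 0 (by omega); simp at this
    have hxd : ∀ y ∈ Ioo 0 a, HasDerivAt x (derivWithin x (Icc 0 a) y) y := by
      intro y hy
      have h1 := (hx.differentiableOn (by simp) y ⟨hy.1.le, hy.2.le⟩).hasDerivWithinAt
      exact h1.hasDerivAt (Icc_mem_nhds hy.1 hy.2)
    have hx' : ContDiffOn ℝ (m : ℕ) (derivWithin x (Icc 0 a)) (Icc 0 a) :=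
      hx.derivWithin hu (by exact_mod_cast le_rfl)
    have hy : ∀ i, ∃ ξ y, i ≤ m + 1 → z i < ξ ∧ ξ < y ∧ y < z (i+1) ∧ x ξ = 0 ∧
        0 < (-e) * (-1)^i * derivWithin x (Icc 0 a) y := by
      intro i
      by_cases hi : i ≤ m + 1
      swap
      · exact ⟨0, 0, fun h => absurd h hi⟩
      have hi1 := hz i hi
      have hb1 := hzα i (by omega)
      have hb2 := hzβ (i+1) (by omega)
      have hc : ContinuousOn (fun t => e * (-1)^i * x t) (Icc (z i) (z (i+1))) :=
        continuousOn_const.mul (hx.continuousOn.mono (Icc_subset_Icc (by linarith) (by linarith)))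
      have h0 := hs i (by omega)
      have h1 := hs (i+1) (by omega)
      rw [pow_succ] at h1
      obtain ⟨ξ, hξ, hξ0⟩ := intermediate_value_Ioo' hi1.le hc
        (show (0:ℝ) ∈ Ioo (e * (-1)^i * x (z (i+1))) (e * (-1)^i * x (z i)) by
          constructor <;> linarith)
      have hx0 : x ξ = 0 := by simpa [he] using hξ0
      obtain ⟨y, hy, hye⟩ := exists_hasDerivAt_eq_slope x (derivWithin x (Icc 0 a)) hξ.2
        (hx.continuousOn.mono (Icc_subset_Icc (by linarith [hξ.1]) (by linarith)))
        (fun w hw => hxd w ⟨by linarith [hw.1, hξ.1], by linarith [hw.2]⟩)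
      refine ⟨ξ, y, fun _ => ⟨hξ.1, hy.1, hy.2, hx0, ?_⟩⟩
      rw [hye, hx0, sub_zero, ← mul_div_assoc]
      apply div_pos _ (by linarith [hξ.2])
      linarith
    choose ξ y hy using hy
    have hbd := ih (by omega) (derivWithin x (Icc 0 a)) (-e) y hx'
      (fun s t h1 h2 h3 => by
        have := hinc s t h1 h2 h3
        simpa only [iteratedDerivWithin_succ'] using this)
      (fun i hi => by
        have h1 := hy i (by omega)
        have h2 := hy (i+1) (by omega)
        linarith [h1.2.2.1, h2.1, h2.2.1])
      (by have h1 := hy 0 (by omega); linarith [h1.1, h1.2.1])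
      (by have h1 := hy (m+1) (by omega); linarith [h1.2.2.1])
      (fun i hi => (hy i hi).2.2.2.2)
    obtain ⟨h1, h2, h3, h4, -⟩ := hy 0 (by omega)
    have htξ : t ≤ ξ 0 := by linarith
    have hξβ : y 0 ≤ β := by have := hzβ 1 (by omega); rw [zero_add] at h3; linarith
    have hsub : Icc t (ξ 0) ⊆ Icc 0 a := Icc_subset_Icc (by linarith) (by linarith)
    have hii : IntervalIntegrable (derivWithin x (Icc 0 a)) volume t (ξ 0) := by
      apply ContinuousOn.intervalIntegrable
      rw [uIcc_of_le htξ]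
      exact hx'.continuousOn.mono hsub
    have hftc := intervalIntegral.integral_eq_sub_of_hasDerivAt_of_le htξ
      (hx.continuousOn.mono hsub)
      (fun w hw => hxd w ⟨by linarith [hw.1], by linarith [hw.2]⟩) hii
    rw [h4, zero_sub] at hftc
    have hQi : IntervalIntegrable (Q (m+1)) volume t (ξ 0) := by
      apply ContinuousOn.intervalIntegrable
      rw [uIcc_of_le htξ]
      exact (hQc (m+1)).mono (Icc_subset_Icc ht1 (by linarith))
    have hle := intervalIntegral.norm_integral_le_of_norm_le htξ
      (f := derivWithin x (Icc 0 a)) (g := Q (m+1)) (Eventually.of_forall (fun w hw =>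
        hbd w (by linarith [hw.1]) (by linarith [hw.2]))) hQi
    rw [hftc, norm_neg, Real.norm_eq_abs] at hle
    exact hle.trans (hQ (m+1) (by omega) t (ξ 0) ht1 htξ (by linarith))

theorem fwd_block {f g G : ℝ → ℝ} (hg_c : ContinuousOn g (Ici 0))
    (hg_pos : ∀ t ∈ Ici (0:ℝ), 0 < g t) {r n : ℕ} {a : ℝ} (ha : 0 < a)
    (hf_pos : ∀ t ∈ Ici (0:ℝ), 0 < f t)
    (hG : InGamma g (r+1) n a G) {b : ℕ → ℝ} (hb : OscPointsAt f (r+1) n a G b)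
    (hw : 0 < wNorm G f (Icc 0 a)) (i0 : ℕ) (hi0 : 1 ≤ i0) (hi1 : i0 + r + 1 ≤ n + r + 2)
    (Q : ℕ → ℝ → ℝ) (hQc : ∀ k, ContinuousOn (Q k) (Icc (b i0) (b (i0 + r + 1))))
    (hQ : ∀ k < r + 1, ∀ s t, b i0 ≤ s → s ≤ t → t ≤ b (i0 + r + 1) →
      ∫ x in s..t, Q k x ≤ Q (k+1) s)
    (hQ1 : ∀ s t, b i0 ≤ s → s ≤ t → t ≤ b (i0 + r + 1) → ∫ x in s..t, g x ≤ Q 1 s) :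
    wNorm G f (Icc 0 a) * f (b i0) ≤ Q (r+1) (b i0) := by
  obtain ⟨m, hm, u, ε, hsp⟩ := hG
  obtain ⟨hb0, hb1, hbi, hbv⟩ := hb
  have hbm : ∀ i j, 1 ≤ i → i ≤ j → j ≤ n + (r+1) + 1 → b i ≤ b j := by
    intro i j hi hij
    induction j, hij using Nat.le_induction with
    | base => intro _; exact le_rfl
    | succ j hij ih => intro hj; exact (ih (by omega)).trans (hbi j (by omega) (by omega)).le
  have hα : 0 ≤ b i0 := hb0.trans (hbm 1 i0 le_rfl hi0 (by omega))
  have hβ : b (i0 + r + 1) ≤ a := by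
    rw [← hb1]; exact hbm _ _ (by omega) (by omega) le_rfl
  have key := chain ha hα hβ Q (r+1) hQc hQ r le_rfl G ((-1)^(i0 + (r+1) + 1))
    (fun i => b (i0 + i)) hsp.2.2.2.2.1
    (fun s t h1 h2 h3 => (spline_incr hg_c hg_pos ha hsp (hα.trans h1) h2 (h3.trans hβ)).trans
      (hQ1 s t h1 h2 h3))
    (fun i hi => hbi (i0 + i) (by omega) (by omega)) le_rfl le_rfl
    (fun i hi => by
      rw [hbv (i0 + i) (by omega) (by omega)]
      have hpos : 0 < wNorm G f (Icc 0 a) * f (b (i0 + i)) :=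
        mul_pos hw (hf_pos _ (hb0.trans (hbm 1 _ le_rfl (by omega) (by omega))))
      have hsq : ((-1:ℝ)^(i0 + (r+1) + 1) * (-1)^i) * (-1)^(i0 + i + (r+1) + 1) = 1 := by
        rw [← pow_add, ← pow_add]
        apply Even.neg_one_pow
        exact ⟨i0 + i + (r+1) + 1, by ring⟩
      rw [← mul_assoc, hsq, one_mul]
      exact hpos) (b i0) le_rfl le_rfl
  rw [hbv i0 hi0 (by omega), abs_mul, abs_pow, abs_neg, abs_one, one_pow, one_mul] at key
  exact (le_abs_self _).trans key

theorem fwd {f g : ℝ → ℝ}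
    (hf_pos : ∀ t ∈ Ici (0:ℝ), 0 < f t)
    (hf_anti : AntitoneOn f (Ici 0))
    (hg_c : ContinuousOn g (Ici 0)) (hg_pos : ∀ t ∈ Ici (0:ℝ), 0 < g t)
    (hg_anti : AntitoneOn g (Ici 0))
    (r : ℕ) (φ : ℕ → ℝ → ℝ)
    (hφ : ∀ n, ∀ a, 0 < a → ∃ G : ℝ → ℝ,
      IsExtremalSpline f g (r+1) n a G ∧ φ n a = wNorm G f (Icc 0 a))
    (hP : ∀ k ≤ r + 1, ∀ t, 0 ≤ t → 0 < Pfun g k t)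
    (Λ : ℕ → ℝ) (hΛ : ∀ n, Tendsto (φ n) atTop (nhds (Λ n)))
    (ℓ : ℝ) (hℓ : Tendsto Λ atTop (nhds ℓ)) (h0 : 0 < ℓ)
    (hno : ∀ c : ℝ, ∀ᶠ t in (atTop : Filter ℝ), c < f t / |Pfun g (r+1) t|) : False := by
  set δ := ℓ / 2 with hδ
  have hδ0 : 0 < δ := by linarith
  obtain ⟨T0, hT0⟩ := eventually_atTop.1 (hno (1/δ))
  set T := max T0 1 with hT
  have hT1 : 1 ≤ T := le_max_right _ _
  have hfP : ∀ t, T ≤ t → Pfun g (r+1) t < δ * f t := by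
    intro t ht
    have h1 := hT0 t ((le_max_left _ _).trans ht)
    have h2 := hP (r+1) le_rfl t (by linarith)
    rw [abs_of_pos h2, div_lt_div_iff₀ hδ0 h2] at h1
    linarith
  have hfT : 0 < f T := hf_pos T (by show (0:ℝ) ≤ T; linarith)
  have hlim : Tendsto (fun J : ℕ => g 0 * (T / (J:ℝ))^(r+1)) atTop (𝓝 0) := by
    have h1 : Tendsto (fun J : ℕ => T / (J:ℝ)) atTop (𝓝 0) := tendsto_const_div_atTop_nhds_zero_nat T
    have := (h1.pow (r+1)).const_mul (g 0)
    simpa using this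
  have hJ : Tendsto (fun J : ℕ => (r+1) * J) atTop atTop :=
    tendsto_id.const_mul_atTop' (by omega)
  obtain ⟨J, hJ1, hJ2, hJ0⟩ := ((hlim.eventually (gt_mem_nhds (mul_pos hδ0 hfT))).and
    ((hJ.eventually (hℓ.eventually (lt_mem_nhds (show δ < ℓ by linarith)))).and
      (eventually_gt_atTop 0))).exists
  set n := (r+1) * J with hn
  obtain ⟨a, ha1, ha0⟩ := (((hΛ n).eventually (lt_mem_nhds hJ2)).and (eventually_gt_atTop 0)).exists
  obtain ⟨G, ⟨hGam, b, hb⟩, hφe⟩ := hφ n a ha0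
  rw [hφe] at ha1
  have hw : 0 < wNorm G f (Icc 0 a) := hδ0.trans ha1
  have hbi := hb.2.2.1
  have hbm : ∀ i j, 1 ≤ i → i ≤ j → j ≤ n + (r+1) + 1 → b i ≤ b j := by
    intro i j hi hij
    induction j, hij using Nat.le_induction with
    | base => intro _; exact le_rfl
    | succ j hij ih => intro hj; exact (ih (by omega)).trans (hbi j (by omega) (by omega)).le
  rcases le_or_gt T (b (n+1)) with hc | hc
  · have hb0 : 0 ≤ b (n+1) := by linarith
    have hPint : ∀ k < r + 1, ∀ s t, b (n+1) ≤ s → s ≤ t → ∫ x in s..t, Pfun g k x ≤ Pfun g (k+1) s := by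
      intro k hk s t hs hst
      have hii : IntervalIntegrable (fun x => -(Pfun g k x)) volume s t := by
        apply ContinuousOn.intervalIntegrable
        apply ((Pfun_contOn hg_c k).neg).mono
        rw [uIcc_of_le hst]
        exact fun x hx => show (0:ℝ) ≤ x by linarith [hx.1]
      have := intervalIntegral.integral_eq_sub_of_hasDerivAt_of_le hst
        ((Pfun_contOn hg_c (k+1)).mono (fun x hx => show (0:ℝ) ≤ x by linarith [hx.1]))
        (fun x hx => Pfun_hasDerivAt hg_c k (by linarith [hx.1])) hii
      rw [intervalIntegral.integral_neg] at this
      have h2 := hP (k+1) (by omega) t (by linarith)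
      linarith
    have key := fwd_block hg_c hg_pos ha0 hf_pos hGam hb hw (n+1) (by omega) (by omega)
      (Pfun g) (fun k => (Pfun_contOn hg_c k).mono
        (fun x hx => show (0:ℝ) ≤ x by linarith [hx.1]))
      (fun k hk s t h1 h2 _ => hPint k hk s t h1 h2)
      (fun s t h1 h2 _ => by
        have := hPint 0 (by omega) s t h1 h2
        rwa [Pfun_zero] at this)
    have h1 := hfP _ hc
    have h2 : 0 < f (b (n+1)) := hf_pos _ hb0
    nlinarith
  · have hJr : (0:ℝ) < J := by exact_mod_cast hJ0
    obtain ⟨j, hj, hjle⟩ : ∃ j ∈ Finset.range J, b (1 + (r+1) * (j+1)) - b (1 + (r+1) * j) ≤ T / J := by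
      apply Finset.exists_le_of_sum_le (by simpa using hJ0.ne')
      rw [Finset.sum_range_sub (fun j => b (1 + (r+1) * j))]
      simp only [Finset.sum_const, Finset.card_range, nsmul_eq_mul]
      have h1 := hb.1
      rw [mul_zero, add_zero, mul_div_cancel₀ _ hJr.ne', add_comm 1, ← hn]
      linarith
    have hj := Finset.mem_range.1 hj
    set i0 := 1 + (r+1) * j with hi0
    have hi0n : i0 + (r + 1) ≤ n + 1 := by
      have : (r+1) * (j+1) ≤ (r+1) * J := Nat.mul_le_mul_left _ hj
      rw [mul_add] at this
      omega
    have hend : 1 + (r+1) * (j+1) = i0 + r + 1 := by rw [hi0]; ring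
    rw [hend] at hjle
    set h := T / (J:ℝ) with hh
    have hh0 : 0 ≤ h := by positivity
    have hg0 : 0 < g 0 := hg_pos 0 self_mem_Ici
    have hbi0 : 0 ≤ b i0 := hb.1.trans (hbm 1 i0 le_rfl (by omega) (by omega))
    have key := fwd_block hg_c hg_pos ha0 hf_pos hGam hb hw i0 (by omega) (by omega)
      (fun k _ => g 0 * h^k) (fun k => continuousOn_const)
      (fun k hk s t h1 h2 h3 => by
        rw [intervalIntegral.integral_const, smul_eq_mul, pow_succ]
        have : t - s ≤ h := by linarith
        have h5 : 0 ≤ g 0 * h^k := by positivity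
        nlinarith)
      (fun s t h1 h2 h3 => by
        have h4 : ∫ x in s..t, g x ≤ ∫ x in s..t, g 0 := by
          apply intervalIntegral.integral_mono_on h2
            (gk_intervalIntegrable hg_c 0 (by linarith) (by linarith)) (by simp)
          intro x hx
          have hx0 : (0:ℝ) ≤ x := by linarith [hx.1]
          exact hg_anti self_mem_Ici hx0 hx0
        rw [intervalIntegral.integral_const, smul_eq_mul] at h4
        have : t - s ≤ h := by linarith
        rw [pow_one]
        nlinarith)
    have hble : b i0 ≤ T := (hbm i0 (n+1) (by omega) (by omega) (by omega)).trans hc.le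
    have hff : f T ≤ f (b i0) := hf_anti hbi0 (by show (0:ℝ) ≤ T; linarith) hble
    nlinarith

theorem bwd_block {f g : ℝ → ℝ}
    (hf_pos : ∀ t ∈ Ici (0:ℝ), 0 < f t) (hf_anti : AntitoneOn f (Ici 0))
    (hg_c : ContinuousOn g (Ici 0)) (r : ℕ)
    (hP : ∀ t, 0 ≤ t → 0 < Pfun g r t) (hP0 : Tendsto (Pfun g r) atTop (𝓝 0))
    (K ε : ℝ) (hK : 1 ≤ K) (hε0 : 0 < ε) (hεK : ε * K = 1 / 2)
    (hfr : ∃ᶠ t in (atTop : Filter ℝ), f t ≤ K * Pfun g r t) (T : ℝ) :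
    ∃ T', T < T' ∧ (0 ≤ T → ∀ (σ : ℝ) (p : Polynomial ℝ), |σ| = 1 → p.degree < (r:ℕ) →
      ¬ ∀ t ∈ Ioo T T', |σ * Pfun g r t + p.eval t| ≤ ε * f t) := by
  by_cases hT : 0 ≤ T
  swap
  · exact ⟨T + 1, by linarith, fun h => absurd h hT⟩
  have hKpos : 0 < K := by linarith
  have hε1 : ε ≤ 1 / 2 := by nlinarith
  obtain ⟨t0, hft0, ht0⟩ := (hfr.and_eventually (eventually_gt_atTop T)).exists
  have hPt0 : 0 < Pfun g r t0 := hP t0 (by linarith)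
  have hev : ∀ᶠ t in (atTop : Filter ℝ), Pfun g r t < Pfun g r t0 / 8 / K :=
    hP0.eventually (gt_mem_nhds (by positivity))
  obtain ⟨S, hfS, hPS, hS⟩ := (hfr.and_eventually (hev.and (eventually_gt_atTop t0))).exists
  obtain ⟨B, hB⟩ : ∃ B, ∀ t, 0 ≤ t → Pfun g r t ≤ B := by
    obtain ⟨N, hN⟩ := eventually_atTop.1 (hP0.eventually (gt_mem_nhds (zero_lt_one)))
    obtain ⟨B, hB⟩ := isCompact_Icc.exists_bound_of_continuousOn (f := Pfun g r)
      ((Pfun_contOn hg_c r).mono (show Icc (0:ℝ) N ⊆ Ici 0 from Icc_subset_Ici_self))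
    refine ⟨max B 1, fun t ht => ?_⟩
    rcases le_total t N with h | h
    · exact ((le_abs_self _).trans (hB t ⟨ht, h⟩)).trans (le_max_left _ _)
    · exact (hN t h).le.trans (le_max_right _ _)
  obtain ⟨T', hT1, hT2, hT3, hfl⟩ := poly_flat r T t0 S (f 0 + B) (Pfun g r t0 / 8) (by positivity)
  refine ⟨T', hT1, fun _ σ p hσ hp hall => ?_⟩
  have hpP : ∀ t ∈ Ioo T T', |p.eval t| ≤ ε * f t + Pfun g r t := by
    intro t ht
    have h1 := hall t ht
    have h2 : |σ * Pfun g r t| = Pfun g r t := by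
      rw [abs_mul, hσ, one_mul, abs_of_pos (hP t (by linarith [ht.1]))]
    have h3 : p.eval t = (σ * Pfun g r t + p.eval t) - σ * Pfun g r t := by ring
    rw [h3]
    exact (abs_sub _ _).trans (by linarith)
  have hflat := hfl p hp (fun x hx => by
    have hx0 : 0 ≤ x := by linarith [hx.1]
    have h1 := hpP x hx
    have h2 : f x ≤ f 0 := hf_anti self_mem_Ici hx0 hx0
    have h3 := hf_pos x hx0
    have h4 := hB x hx0
    nlinarith)
  have hpS := hpP S ⟨by linarith, hT2⟩
  have hA := hall t0 ⟨ht0, hT3⟩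
  have h1 : ε * f t0 ≤ Pfun g r t0 / 2 := by
    calc ε * f t0 ≤ ε * (K * Pfun g r t0) := by gcongr
      _ = Pfun g r t0 / 2 := by rw [← mul_assoc, hεK]; ring
  have hKP : K * Pfun g r S < Pfun g r t0 / 8 := by
    rw [lt_div_iff₀ hKpos] at hPS; linarith
  have hPSp : 0 < Pfun g r S := hP S (by linarith)
  have h2 : Pfun g r S ≤ K * Pfun g r S := by nlinarith
  have h3 : ε * f S ≤ Pfun g r t0 / 16 := by
    calc ε * f S ≤ ε * (K * Pfun g r S) := by gcongr
      _ ≤ 1/2 * (Pfun g r t0 / 8) := by gcongr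
      _ = _ := by ring
  have h4 : |σ * Pfun g r t0| = Pfun g r t0 := by
    rw [abs_mul, hσ, one_mul, abs_of_pos hPt0]
  have h5 : σ * Pfun g r t0 = (σ * Pfun g r t0 + p.eval t0) - p.eval t0 := by ring
  have h6 : |σ * Pfun g r t0| ≤ |σ * Pfun g r t0 + p.eval t0| + |p.eval t0| := by
    conv_lhs => rw [h5]
    exact abs_sub _ _
  have h7 : |p.eval t0| ≤ |p.eval t0 - p.eval S| + |p.eval S| := by
    have := abs_add_le (p.eval t0 - p.eval S) (p.eval S)
    simpa using this
  linarith

theorem bwd {f g : ℝ → ℝ}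
    (hf_c : ContinuousOn f (Ici 0))
    (hf_pos : ∀ t ∈ Ici (0:ℝ), 0 < f t) (hf_anti : AntitoneOn f (Ici 0))
    (hg_c : ContinuousOn g (Ici 0)) (r : ℕ) (φ : ℕ → ℝ → ℝ)
    (hφ : ∀ n, ∀ a, 0 < a → ∃ G : ℝ → ℝ,
      IsExtremalSpline f g r n a G ∧ φ n a = wNorm G f (Icc 0 a))
    (hP : ∀ t, 0 ≤ t → 0 < Pfun g r t) (hP0 : Tendsto (Pfun g r) atTop (𝓝 0))
    (Λ : ℕ → ℝ) (hΛ : ∀ n, Tendsto (φ n) atTop (nhds (Λ n)))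
    (ℓ : ℝ) (hℓ : Tendsto Λ atTop (nhds ℓ)) (c : ℝ)
    (hc : ∃ᶠ t in (atTop : Filter ℝ), f t / |Pfun g r t| ≤ c) : 0 < ℓ := by
  by_contra hneg
  have hneg := not_lt.1 hneg
  set K := max c 1 with hKd
  have hK : 1 ≤ K := le_max_right _ _
  have hKpos : 0 < K := by linarith
  set ε := 1 / (2 * K) with hεd
  have hε0 : 0 < ε := by positivity
  have hεK : ε * K = 1 / 2 := by rw [hεd]; field_simp
  have hfr : ∃ᶠ t in (atTop : Filter ℝ), f t ≤ K * Pfun g r t := by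
    refine (hc.and_eventually (eventually_ge_atTop 0)).mono ?_
    rintro t ⟨h1, h2⟩
    have hp := hP t h2
    rw [abs_of_pos hp, div_le_iff₀ hp] at h1
    exact h1.trans (mul_le_mul_of_nonneg_right (le_max_left _ _) hp.le)
  choose nx hnx1 hnx2 using bwd_block hf_pos hf_anti hg_c r hP hP0 K ε hK hε0 hεK hfr
  let T : ℕ → ℝ := fun i => nx^[i] 0
  have hTs : ∀ i, T (i+1) = nx (T i) := fun i => Function.iterate_succ_apply' nx i 0
  have hTlt : ∀ i, T i < T (i+1) := fun i => by rw [hTs]; exact hnx1 _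
  have hTm : StrictMono T := strictMono_nat_of_lt_succ hTlt
  have hT0 : T 0 = 0 := rfl
  have hTn : ∀ i, 0 ≤ T i := fun i => by rw [← hT0]; exact hTm.monotone (Nat.zero_le i)
  obtain ⟨n, hn⟩ := (hℓ.eventually (gt_mem_nhds (lt_of_le_of_lt hneg hε0))).exists
  obtain ⟨a, ha1, ha2⟩ := (((hΛ n).eventually (gt_mem_nhds hn)).and
    (eventually_ge_atTop (T (n+1)))).exists
  have ha : 0 < a := by
    have := hTm (Nat.succ_pos n)
    rw [hT0] at this
    exact lt_of_lt_of_le this ha2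
  obtain ⟨G, ⟨⟨m, hm, u, e, he, hu0, hu1, hum, hcd, hsp⟩, -⟩, hw⟩ := hφ n a ha
  have hfree : ∃ i ≤ m, u i ≤ T i ∧ T (i+1) ≤ u (i+1) := by
    by_contra! hcon
    have : ∀ i ≤ m, u (i+1) < T (i+1) := by
      intro i
      induction i with
      | zero => intro h; exact hcon 0 h (by rw [hu0, hT0])
      | succ i ih => intro h; exact hcon (i+1) h (ih (by omega)).le
    have h1 := this m le_rfl
    have h2 : T (m+1) ≤ T (n+1) := hTm.monotone (by omega)
    rw [hu1] at h1
    linarith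
  obtain ⟨i, hi, hui, hui2⟩ := hfree
  have humono : ∀ i j, i ≤ j → j ≤ m + 1 → u i ≤ u j := by
    intro i j hij
    induction j, hij using Nat.le_induction with
    | base => intro _; exact le_rfl
    | succ j hij ih => intro hj; exact (ih (by omega)).trans (hum j (by omega)).le
  have hu_nonneg : 0 ≤ u i := by
    have := humono 0 i (by omega) (by omega)
    rwa [hu0] at this
  have hu_le : u (i+1) ≤ a := by
    have := humono (i+1) (m+1) (by omega) le_rfl
    rwa [hu1] at this
  obtain ⟨p, hp, hpe⟩ := poly_rep hg_c (e * (-1)^i) (u i) (u (i+1)) hu_nonneg (hum i hi) r G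
    (hsp i hi).1 (hsp i hi).2
  set τ := e * (-1)^i * (-1)^r with hτ
  have hτ1 : |τ| = 1 := by
    rw [hτ, abs_mul, abs_mul]
    rcases he with h | h <;> simp [h]
  refine hnx2 (T i) (hTn i) τ (p - Polynomial.C τ * Ppoly g r) hτ1
    ((Polynomial.degree_sub_le _ _).trans_lt
      (max_lt hp (deg_C_mul τ _ r (Ppoly_degree g r)))) ?_
  intro t ht
  rw [← hTs] at ht
  have htu : t ∈ Ioo (u i) (u (i+1)) := ⟨by linarith [ht.1], by linarith [ht.2]⟩
  have hta : t ∈ Icc 0 a := ⟨by linarith [htu.1], by linarith [htu.2]⟩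
  have hpow : ((-1:ℝ)^r) * (-1)^r = 1 := by rw [← mul_pow]; simp
  have hG : τ * Pfun g r t + (p - Polynomial.C τ * Ppoly g r).eval t = G t := by
    rw [hpe t htu, Pfun_eq]
    simp only [Polynomial.eval_sub, Polynomial.eval_mul, Polynomial.eval_C]
    rw [hτ]
    linear_combination (e * (-1)^i * gk g r t) * hpow
  rw [hG]
  refine (le_wNorm hf_c hf_pos hcd.continuousOn hta).trans ?_
  rw [← hw]
  exact mul_le_mul_of_nonneg_right ha1.le (hf_pos t hta.1).le


/-- Theorem 6: if φ_{r,0,f}(∞) < ∞ then lim_{n→∞} φ_{r,n,f}(∞) > 0 if and only if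
liminf_{t→∞} f(t)/|P_r(t)| < ∞ (i.e. f/|P_r| is frequently bounded at ∞). -/
theorem statement17
    (f g : ℝ → ℝ)
    (hf_c : ContinuousOn f (Ici 0)) (hf_pos : ∀ t ∈ Ici (0:ℝ), 0 < f t)
    (hf_anti : AntitoneOn f (Ici 0))
    (hg_c : ContinuousOn g (Ici 0)) (hg_pos : ∀ t ∈ Ici (0:ℝ), 0 < g t)
    (hg_anti : AntitoneOn g (Ici 0))
    (r : ℕ) (hr : 1 ≤ r)
    (φ : ℕ → ℝ → ℝ)
    (hφ : ∀ n, ∀ a, 0 < a → ∃ G : ℝ → ℝ,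
      IsExtremalSpline f g r n a G ∧ φ n a = wNorm G f (Icc 0 a))
    (hfin : ∃ C, ∀ a, 0 < a → φ 0 a ≤ C)
    (Λ : ℕ → ℝ) (hΛ : ∀ n, Tendsto (φ n) atTop (nhds (Λ n)))
    (ℓ : ℝ) (hℓ : Tendsto Λ atTop (nhds ℓ)) :
    0 < ℓ ↔ ∃ c : ℝ, ∃ᶠ t in (atTop : Filter ℝ), f t / |Pfun g r t| ≤ c := by
  obtain ⟨C, hC⟩ := hfin
  obtain ⟨q, hq, M, hM⟩ := exists_bounded hf_c hf_pos hf_anti hg_c r C (fun a ha => by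
    obtain ⟨G, h1, h2⟩ := hφ 0 a ha
    exact ⟨G, h1, h2 ▸ hC a ha⟩)
  have hgood := fun k hk => good_P hg_c hg_pos r q hq M hM k hk
  constructor
  · intro h0
    obtain ⟨r, rfl⟩ := Nat.exists_eq_add_of_le' hr
    by_contra hno
    refine fwd hf_pos hf_anti hg_c hg_pos hg_anti r φ hφ (fun k hk => (hgood k hk).1) Λ hΛ ℓ hℓ h0 ?_
    intro c
    have h1 := not_exists.1 hno c
    rw [not_frequently] at h1
    exact h1.mono (fun t ht => not_le.1 ht)
  · rintro ⟨c, hc⟩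
    exact bwd hf_c hf_pos hf_anti hg_c r φ hφ (hgood r le_rfl).1 ((hgood r le_rfl).2.1 hr) Λ hΛ ℓ hℓ c hc
end

section
/- Let f(t) := e^{−(t+√3)²/2} and g(t) := ((t+√3)² − 1)·e^{−(t+√3)²/2} for t ≥ 0. Then f and g are continuous, positive and non-increasing on [0,∞); A_0 = ∫_0^∞ g(t) dt = √3·e^{−3/2} < ∞; P_1(t) = −(t+√3)·e^{−(t+√3)²/2}; A_1 = ∫_0^∞ |P_1(t)| dt = e^{−3/2} < ∞; P_2(t) = e^{−(t+√3)²/2}; and sup_{t≥0} |P_2(t)|/f(t) = 1 < ∞ while sup_{t≥0} |P_1(t)|/f(t) = ∞. In particular, condition (7) holds for r = 2 but fails for r = 1. -/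
open Set Filter MeasureTheory
open scoped Topology

noncomputable section

/-- The weight `f(t) = e^{-(t+√3)²/2}`. -/
def fEx : ℝ → ℝ := fun t => Real.exp (-(t + Real.sqrt 3) ^ 2 / 2)

/-- The weight `g(t) = ((t+√3)² - 1)·e^{-(t+√3)²/2}`. -/
def gEx : ℝ → ℝ := fun t => ((t + Real.sqrt 3) ^ 2 - 1) * Real.exp (-(t + Real.sqrt 3) ^ 2 / 2)

/-- `A₀ = ∫_0^∞ g`. -/
def A0Ex : ℝ := ∫ t in Ioi (0 : ℝ), gEx t

/-- `g₁(t) = ∫_0^t g`. -/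
def g1Ex : ℝ → ℝ := fun t => ∫ s in (0:ℝ)..t, gEx s

/-- `P₁(t) = -A₀ + g₁(t)`. -/
def P1Ex : ℝ → ℝ := fun t => -A0Ex + g1Ex t

/-- `A₁ = ∫_0^∞ |P₁|`. -/
def A1Ex : ℝ := ∫ t in Ioi (0 : ℝ), |P1Ex t|

/-- `g₂(t) = ∫_0^t g₁`. -/
def g2Ex : ℝ → ℝ := fun t => ∫ s in (0:ℝ)..t, g1Ex s

/-- `P₂(t) = A₁ - A₀·t + g₂(t)`. -/
def P2Ex : ℝ → ℝ := fun t => A1Ex - A0Ex * t + g2Ex t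

end

lemma hF (t : ℝ) : HasDerivAt fEx (-(t + Real.sqrt 3) * fEx t) t := by
  unfold fEx
  have h : HasDerivAt (fun t : ℝ => -(t + Real.sqrt 3) ^ 2 / 2) (-(t + Real.sqrt 3)) t := by
    have := ((((hasDerivAt_id t).add_const (Real.sqrt 3)).pow 2).neg).div_const 2
    refine this.congr_deriv ?_
    simp; ring
  convert h.exp using 1
  ring

lemma hH (t : ℝ) : HasDerivAt (fun t => -(t + Real.sqrt 3) * fEx t) (gEx t) t := by
  have := (((hasDerivAt_id t).add_const (Real.sqrt 3)).neg).mul (hF t)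
  refine this.congr_deriv ?_
  simp [gEx, fEx]; ring

lemma hG (t : ℝ) : HasDerivAt gEx ((t + Real.sqrt 3) * (3 - (t + Real.sqrt 3) ^ 2) * fEx t) t := by
  have := ((((hasDerivAt_id t).add_const (Real.sqrt 3)).pow 2).sub_const 1).mul (hF t)
  refine (this : HasDerivAt gEx _ t).congr_deriv ?_
  simp; ring

lemma f_pos (t : ℝ) : 0 < fEx t := Real.exp_pos _

lemma f_cont : Continuous fEx := continuous_iff_continuousAt.2 fun t => (hF t).continuousAt
lemma g_cont : Continuous gEx := continuous_iff_continuousAt.2 fun t => (hG t).continuousAt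

lemma s3 : 0 < Real.sqrt 3 := by positivity
lemma s3sq : Real.sqrt 3 ^ 2 = 3 := Real.sq_sqrt (by norm_num)

lemma g_pos (t : ℝ) (ht : 0 ≤ t) : 0 < gEx t := by
  unfold gEx
  refine mul_pos ?_ (Real.exp_pos _)
  nlinarith [s3, s3sq, mul_nonneg ht s3.le]

lemma f_zero : fEx 0 = Real.exp (-(3/2 : ℝ)) := by
  unfold fEx
  congr 1
  have := s3sq
  rw [zero_add, neg_div, this]

lemma f_bound (x : ℝ) (hx : 0 < x) : x * Real.exp (-x ^ 2 / 2) ≤ 2 / x := by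
  have h := Real.add_one_le_exp (x ^ 2 / 2)
  rw [neg_div, Real.exp_neg, ← div_eq_mul_inv, div_le_div_iff₀ (Real.exp_pos _) hx]
  nlinarith

lemma lim_shift : Tendsto (fun t : ℝ => t + Real.sqrt 3) atTop atTop :=
  tendsto_atTop_add_const_right _ _ tendsto_id

lemma lim_aux : Tendsto (fun t : ℝ => (t + Real.sqrt 3) * fEx t) atTop (𝓝 0) := by
  have h2 : Tendsto (fun t : ℝ => 2 / (t + Real.sqrt 3)) atTop (𝓝 0) :=
    lim_shift.const_div_atTop 2
  refine tendsto_of_tendsto_of_tendsto_of_le_of_le' tendsto_const_nhds h2 ?_ ?_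
  · filter_upwards [eventually_ge_atTop 0] with t ht
    have := s3; have := f_pos t; positivity
  · filter_upwards [eventually_ge_atTop 0] with t ht
    exact f_bound _ (by have := s3; positivity)

lemma lim_H : Tendsto (fun t : ℝ => -(t + Real.sqrt 3) * fEx t) atTop (𝓝 0) := by
  have := lim_aux.neg
  simpa only [neg_mul, neg_zero] using this

lemma lim_F : Tendsto fEx atTop (𝓝 0) := by
  refine tendsto_of_tendsto_of_tendsto_of_le_of_le' tendsto_const_nhds lim_aux ?_ ?_
  · exact Eventually.of_forall fun t => (f_pos t).le
  · filter_upwards [eventually_ge_atTop 1] with t ht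
    have := s3; have := f_pos t; nlinarith

lemma g_int : IntegrableOn gEx (Ioi 0) :=
  integrableOn_Ioi_deriv_of_nonneg' (fun t _ => hH t) (fun t ht => (g_pos t (le_of_lt ht)).le) lim_H

lemma A0_eq : A0Ex = Real.sqrt 3 * fEx 0 := by
  unfold A0Ex
  rw [integral_Ioi_of_hasDerivAt_of_nonneg' (fun t _ => hH t)
    (fun t ht => (g_pos t (le_of_lt ht)).le) lim_H]
  ring

lemma g1_eq (t : ℝ) : g1Ex t = -(t + Real.sqrt 3) * fEx t + Real.sqrt 3 * fEx 0 := by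
  unfold g1Ex
  rw [intervalIntegral.integral_eq_sub_of_hasDerivAt (fun x _ => hH x)
    (g_cont.intervalIntegrable _ _)]
  ring

lemma P1_eq (t : ℝ) : P1Ex t = -(t + Real.sqrt 3) * fEx t := by
  unfold P1Ex
  rw [A0_eq, g1_eq]; ring

lemma absP1 (t : ℝ) (ht : 0 ≤ t) : |P1Ex t| = (t + Real.sqrt 3) * fEx t := by
  have := s3; have := f_pos t
  rw [P1_eq, neg_mul, abs_neg, abs_of_nonneg (by positivity)]

lemma hnF (t : ℝ) : HasDerivAt (fun t => - fEx t) ((t + Real.sqrt 3) * fEx t) t := by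
  exact (hF t).neg.congr_deriv (by ring)

lemma nn (t : ℝ) (ht : t ∈ Ioi (0:ℝ)) : 0 ≤ (t + Real.sqrt 3) * fEx t := by
  have := s3; have := f_pos t; have : 0 < t := ht
  positivity

lemma lim_nF : Tendsto (fun t => - fEx t) atTop (𝓝 0) := by simpa using lim_F.neg

lemma P1_int : IntegrableOn (fun t => |P1Ex t|) (Ioi 0) := by
  refine (integrableOn_congr_fun (fun t ht => absP1 t (le_of_lt ht)) measurableSet_Ioi).2 ?_
  exact integrableOn_Ioi_deriv_of_nonneg' (fun t _ => hnF t) nn lim_nF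

lemma A1_eq : A1Ex = fEx 0 := by
  unfold A1Ex
  rw [setIntegral_congr_fun measurableSet_Ioi (fun t ht => absP1 t (le_of_lt ht)),
    integral_Ioi_of_hasDerivAt_of_nonneg' (fun t _ => hnF t) nn lim_nF]
  ring

lemma P2_eq (t : ℝ) : P2Ex t = fEx t := by
  have h : g2Ex t = fEx t + Real.sqrt 3 * fEx 0 * t - fEx 0 := by
    unfold g2Ex
    have hd : ∀ x ∈ uIcc 0 t, HasDerivAt (fun t => fEx t + Real.sqrt 3 * fEx 0 * t) (g1Ex x) x := by
      intro x _
      have := (hF x).add ((hasDerivAt_id x).const_mul (Real.sqrt 3 * fEx 0))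
      rw [g1_eq]
      exact this.congr_deriv (by ring)
    have hc : Continuous g1Ex := by
      rw [funext g1_eq]
      have := f_cont
      fun_prop
    rw [intervalIntegral.integral_eq_sub_of_hasDerivAt hd (hc.intervalIntegrable _ _)]
    ring
  unfold P2Ex
  rw [h, A1_eq, A0_eq]; ring

/-- The example from the Remark in §5.1: for `f(t) = e^{-(t+√3)²/2}` and
`g(t) = ((t+√3)² - 1)·e^{-(t+√3)²/2}`, both are continuous, positive and
non-increasing on `[0,∞)`; `A₀ = √3·e^{-3/2} < ∞`;
`P₁(t) = -(t+√3)·e^{-(t+√3)²/2}`; `A₁ = e^{-3/2} < ∞`;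
`P₂(t) = e^{-(t+√3)²/2}`; and `sup_{t≥0} |P₂(t)|/f(t) = 1 < ∞` while
`sup_{t≥0} |P₁(t)|/f(t) = ∞`: condition (7) holds for `r = 2` but fails for `r = 1`. -/
theorem statement18 :
    ContinuousOn fEx (Ici 0) ∧ (∀ t ∈ Ici (0:ℝ), 0 < fEx t) ∧ AntitoneOn fEx (Ici 0) ∧
    ContinuousOn gEx (Ici 0) ∧ (∀ t ∈ Ici (0:ℝ), 0 < gEx t) ∧ AntitoneOn gEx (Ici 0) ∧
    IntegrableOn gEx (Ioi 0) ∧ A0Ex = Real.sqrt 3 * Real.exp (-(3/2 : ℝ)) ∧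
    (∀ t ∈ Ici (0:ℝ), P1Ex t = -(t + Real.sqrt 3) * Real.exp (-(t + Real.sqrt 3) ^ 2 / 2)) ∧
    IntegrableOn (fun t => |P1Ex t|) (Ioi 0) ∧ A1Ex = Real.exp (-(3/2 : ℝ)) ∧
    (∀ t ∈ Ici (0:ℝ), P2Ex t = Real.exp (-(t + Real.sqrt 3) ^ 2 / 2)) ∧
    sSup ((fun t => |P2Ex t| / fEx t) '' Ici 0) = 1 ∧
    ¬ BddAbove ((fun t => |P1Ex t| / fEx t) '' Ici 0) := by
  refine ⟨f_cont.continuousOn, fun t _ => f_pos t, ?_, g_cont.continuousOn, g_pos, ?_, g_int,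
    by rw [A0_eq, f_zero], fun t _ => P1_eq t, P1_int, by rw [A1_eq, f_zero],
    fun t _ => P2_eq t, ?_, ?_⟩
  · refine antitoneOn_of_hasDerivWithinAt_nonpos (convex_Ici 0) f_cont.continuousOn
      (fun t _ => (hF t).hasDerivWithinAt) ?_
    intro t ht
    rw [interior_Ici] at ht
    have := nn t ht
    linarith
  · refine antitoneOn_of_hasDerivWithinAt_nonpos (convex_Ici 0) g_cont.continuousOn
      (fun t _ => (hG t).hasDerivWithinAt) ?_
    intro t ht
    rw [interior_Ici] at ht
    have h0 := nn t ht
    have ht : 0 < t := ht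
    have h1 : 3 - (t + Real.sqrt 3) ^ 2 ≤ 0 := by nlinarith [s3, s3sq, mul_pos ht s3]
    nlinarith
  · have : (fun t => |P2Ex t| / fEx t) = fun _ => (1:ℝ) := by
      funext t
      rw [P2_eq, abs_of_pos (f_pos t), div_self (f_pos t).ne']
    rw [this, Set.Nonempty.image_const ⟨0, by simp⟩, csSup_singleton]
  · rintro ⟨M, hM⟩
    have h := hM ⟨|M| + 1, by simp only [mem_Ici]; positivity, rfl⟩
    simp only at h
    rw [absP1 _ (by positivity), mul_div_assoc, div_self (f_pos _).ne'] at h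
    have := s3
    linarith [le_abs_self M]
end

section
/- Let f and g be continuous, positive, non-increasing functions on [0,∞), let r ∈ ℕ, n ∈ ℕ, a > 0, and let G := G_{r,n,f,a} be the perfect g-spline in Γ^r_{n,g}[0,a] with n+r+1 oscillation points 0 ≤ b_1 < b_2 < ⋯ < b_{n+r+1} = a and knots 0 < t_1 < ⋯ < t_n < a. Then for every s = 1, 2, …, n, at least s of the oscillation points b_1, …, b_{n+r+1} lie in the interval [0, t_s]. -/
open Set Filter MeasureTheory
open scoped Topology

theorem aux_rolle (G : ℝ → ℝ) (c a : ℝ) (q N : ℕ)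
    (hG : ContDiffOn ℝ (q : ℕ) G (Ioo c a)) (z : ℕ → ℝ)
    (hz : ∀ j < N, z j ∈ Ioo c a ∧ G (z j) = 0) (hzm : ∀ j, j + 1 < N → z j < z (j + 1)) :
    ∀ k ≤ q, ∃ w : ℕ → ℝ, (∀ j, j + k < N → w j ∈ Ioo c a ∧ iteratedDeriv k G (w j) = 0) ∧
      ∀ j, j + 1 + k < N → w j < w (j + 1) := by
  intro k
  induction k with
  | zero => 
    intro _
    exact ⟨z, by simpa using hz, by simpa using hzm⟩
  | succ k ih =>
    intro hk
    obtain ⟨w, hw, hwm⟩ := ih (by omega)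
    have key : ∀ j, ∃ y, j + (k + 1) < N → 
        (y ∈ Ioo (w j) (w (j+1)) ∧ iteratedDeriv (k+1) G y = 0) := by
      intro j
      by_cases hj : j + (k + 1) < N
      · have h1 := hw j (by omega)
        have h2 := hw (j+1) (by omega)
        have h3 := hwm j (by omega)
        have hc : ContinuousOn (iteratedDeriv k G) (Icc (w j) (w (j+1))) := by
          have h4 : ContinuousOn (iteratedDerivWithin k G (Ioo c a)) (Ioo c a) :=
            hG.continuousOn_iteratedDerivWithin (by exact_mod_cast (by omega : k ≤ q))
              isOpen_Ioo.uniqueDiffOn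
          have h5 : ContinuousOn (iteratedDeriv k G) (Ioo c a) :=
            h4.congr (fun x hx => (iteratedDerivWithin_of_isOpen isOpen_Ioo hx).symm)
          exact h5.mono (fun x hx => ⟨lt_of_lt_of_le h1.1.1 hx.1, lt_of_le_of_lt hx.2 h2.1.2⟩)
        obtain ⟨y, hy, hy0⟩ := exists_deriv_eq_zero h3 hc (by rw [h1.2, h2.2])
        exact ⟨y, fun _ => ⟨hy, by rw [iteratedDeriv_succ]; exact hy0⟩⟩
      · exact ⟨0, fun h => absurd h hj⟩
    choose y hy using key
    refine ⟨y, fun j hj => ⟨?_, (hy j hj).2⟩, fun j hj => ?_⟩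
    · have h1 := hw j (by omega)
      have h2 := hw (j+1) (by omega)
      have h3 := (hy j hj).1
      exact ⟨h1.1.1.trans h3.1, h3.2.trans h2.1.2⟩
    · exact (hy j (by omega)).1.2.trans (hy (j+1) (by omega)).1.1

theorem aux_ivt (G : ℝ → ℝ) (x y : ℝ) (hxy : x < y) (hc : ContinuousOn G (Icc x y))
    (h : G x * G y < 0) : ∃ z ∈ Ioo x y, G z = 0 := by
  rcases mul_neg_iff.1 h with h | h
  · exact intermediate_value_Ioo' hxy.le hc ⟨h.2, h.1⟩
  · exact intermediate_value_Ioo hxy.le hc ⟨h.1, h.2⟩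

/-- Oscillation points interlace knots: for the extremal spline G_{r,n,f,a} with
knots u 1 < ⋯ < u n and oscillation points b 1 < ⋯ < b (n+r+1), for every
s = 1, …, n at least s of the oscillation points lie in [0, u s]. -/
theorem statement19
    (f g : ℝ → ℝ)
    (hf_c : ContinuousOn f (Ici 0)) (hf_pos : ∀ t ∈ Ici (0:ℝ), 0 < f t)
    (hf_anti : AntitoneOn f (Ici 0))
    (hg_c : ContinuousOn g (Ici 0)) (hg_pos : ∀ t ∈ Ici (0:ℝ), 0 < g t)
    (hg_anti : AntitoneOn g (Ici 0))
    (r : ℕ) (hr : 1 ≤ r) (n : ℕ) (hn : 1 ≤ n) (a : ℝ) (ha : 0 < a)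
    (G : ℝ → ℝ) (u : ℕ → ℝ) (ε : ℝ) (hG : PerfectSplineWith g r a n u ε G)
    (b : ℕ → ℝ) (hb : OscPointsAt f r n a G b) :
    ∀ s, 1 ≤ s → s ≤ n → ∃ T : Finset ℕ, T ⊆ Finset.Icc 1 (n + r + 1) ∧
      s ≤ T.card ∧ ∀ i ∈ T, 0 ≤ b i ∧ b i ≤ u s := by
  intro s hs1 hsn
  obtain ⟨hε, hu0, hua, hum, hGc, hGp⟩ := hG
  obtain ⟨hb1, hba, hbm, hbv⟩ := hb
  have bmono : ∀ d i, 1 ≤ i → i + d ≤ n + r + 1 → b i ≤ b (i + d) := by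
    intro d
    induction d with
    | zero => intro i _ _; exact le_rfl
    | succ d ih =>
      intro i h1 h2
      exact (ih i h1 (by omega)).trans (hbm (i + d) (by omega) (by omega)).le
  have umono : ∀ d i, i + d ≤ n + 1 → u i ≤ u (i + d) := by
    intro d
    induction d with
    | zero => intro i _; exact le_rfl
    | succ d ih =>
      intro i h2
      exact (ih i (by omega)).trans (hum (i + d) (by omega)).le
  have hus : 0 ≤ u s := by
    have := umono s 0 (by omega)
    rw [hu0, Nat.zero_add] at this
    exact this
  have main : b s ≤ u s := by
    by_contra hlt
    push Not at hlt
    have bgt : ∀ i, s ≤ i → i ≤ n + r + 1 → u s < b i := by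
      intro i h1 h2
      obtain ⟨d, rfl⟩ := Nat.exists_eq_add_of_le h1
      exact hlt.trans_le (bmono d s hs1 h2)
    have ble : ∀ i, s ≤ i → i ≤ n + r + 1 → b i ≤ a := by
      intro i h1 h2
      obtain ⟨d, hd⟩ := Nat.exists_eq_add_of_le h2
      have := bmono d i (by omega) (by omega)
      rwa [← hd, hba] at this
    have hG0 : ContinuousOn G (Icc 0 a) := hGc.continuousOn
    -- zeros
    have hz : ∃ z : ℕ → ℝ, (∀ j < n + r + 1 - s, z j ∈ Ioo (u s) a ∧ G (z j) = 0) ∧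
        ∀ j, j + 1 < n + r + 1 - s → z j < z (j + 1) := by
      by_cases hM : wNorm G f (Icc 0 a) = 0
      · refine ⟨fun j => b (s + j), fun j hj => ⟨⟨bgt _ (by omega) (by omega), ?_⟩, ?_⟩,
          fun j hj => hbm (s + j) (by omega) (by omega)⟩
        · exact (hbm (s + j) (by omega) (by omega)).trans_le (ble (s + j + 1) (by omega) (by omega))
        · show G (b (s + j)) = 0
          rw [hbv (s + j) (by omega) (by omega), hM]; simp
      · have key : ∀ j, ∃ y, j < n + r + 1 - s →
            (y ∈ Ioo (b (s + j)) (b (s + j + 1)) ∧ G y = 0) := by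
          intro j
          by_cases hj : j < n + r + 1 - s
          · have p1 := bgt (s + j) (by omega) (by omega)
            have p2 := bgt (s + j + 1) (by omega) (by omega)
            have f1 := hf_pos (b (s + j)) (hus.trans p1.le)
            have f2 := hf_pos (b (s + j + 1)) (hus.trans p2.le)
            obtain ⟨y, hy, hy0⟩ := aux_ivt G (b (s + j)) (b (s + j + 1))
              (hbm (s + j) (by omega) (by omega))
              (hG0.mono (Icc_subset_Icc (hus.trans p1.le) (ble _ (by omega) (by omega)))) (by
                rw [hbv (s + j) (by omega) (by omega), hbv (s + j + 1) (by omega) (by omega)]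
                have e : (-1 : ℝ) ^ (s + j + r + 1) * (-1 : ℝ) ^ (s + j + 1 + r + 1) = -1 := by
                  rw [← pow_add]
                  exact Odd.neg_one_pow ⟨s + j + r + 1, by ring⟩
                have e2 : 0 < wNorm G f (Icc 0 a) ^ 2 * (f (b (s + j)) * f (b (s + j + 1))) := by
                  positivity
                calc _ = ((-1 : ℝ) ^ (s + j + r + 1) * (-1 : ℝ) ^ (s + j + 1 + r + 1)) *
                      (wNorm G f (Icc 0 a) ^ 2 * (f (b (s + j)) * f (b (s + j + 1)))) := by ring
                  _ < 0 := by rw [e]; linarith)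
            exact ⟨y, fun _ => ⟨hy, hy0⟩⟩
          · exact ⟨0, fun h => absurd h hj⟩
        choose y hy using key
        refine ⟨y, fun j hj => ⟨⟨?_, ?_⟩, (hy j hj).2⟩, fun j hj => ?_⟩
        · exact (bgt _ (by omega) (by omega)).trans (hy j hj).1.1
        · exact (hy j hj).1.2.trans_le (ble _ (by omega) (by omega))
        · exact (hy j (by omega)).1.2.trans (hy (j + 1) hj).1.1
    obtain ⟨z, hz, hzm⟩ := hz
    have hGo : ContDiffOn ℝ (r - 1 : ℕ) G (Ioo (u s) a) :=
      hGc.mono (fun x hx => ⟨hus.trans hx.1.le, hx.2.le⟩)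
    obtain ⟨w, hw, hwm⟩ := aux_rolle G (u s) a (r - 1) _ hGo z hz hzm (r - 1) le_rfl
    have hHc : ContinuousOn (iteratedDeriv (r - 1) G) (Ioo (u s) a) :=
      (hGo.continuousOn_iteratedDerivWithin le_rfl isOpen_Ioo.uniqueDiffOn).congr
        (fun x hx => (iteratedDerivWithin_of_isOpen isOpen_Ioo hx).symm)
    have claim : ∀ j, j ≤ n + 1 - s → u (s + j) < w j := by
      intro j
      induction j with
      | zero => intro _; exact (hw 0 (by omega)).1.1
      | succ j ih =>
        intro hj
        have h1 := ih (by omega)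
        have h2 := hw j (by omega)
        have h3 := hw (j + 1) (by omega)
        have h4 := hwm j (by omega)
        by_contra hle
        push Not at hle
        obtain ⟨c, hc, hc0⟩ := exists_deriv_eq_zero h4
          (hHc.mono (fun x hx => ⟨lt_of_lt_of_le h2.1.1 hx.1, lt_of_le_of_lt hx.2 h3.1.2⟩))
          (by rw [h2.2, h3.2])
        have hcI : c ∈ Ioo (u (s + j)) (u (s + j + 1)) := ⟨h1.trans hc.1, hc.2.trans_le hle⟩
        have h5 := (hGp (s + j) (by omega)).2 c hcI
        rw [iteratedDerivWithin_of_isOpen isOpen_Ioo hcI] at h5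
        have h6 : iteratedDeriv r G c = deriv (iteratedDeriv (r - 1) G) c := by
          rw [← iteratedDeriv_succ, Nat.sub_add_cancel hr]
        rw [h6, hc0] at h5
        have h7 := hg_pos c (hus.trans (h2.1.1.trans hc.1).le)
        have h8 : ε ≠ 0 := by rcases hε with h | h <;> rw [h] <;> norm_num
        have h9 : (-1 : ℝ) ^ (s + j) ≠ 0 := pow_ne_zero _ (by norm_num)
        exact mul_ne_zero (mul_ne_zero h8 h9) h7.ne' h5.symm
    have c1 := claim (n + 1 - s) le_rfl
    rw [show s + (n + 1 - s) = n + 1 by omega, hua] at c1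
    exact absurd (hw (n + 1 - s) (by omega)).1.2 c1.le.not_gt
  refine ⟨Finset.Icc 1 s, Finset.Icc_subset_Icc le_rfl (by omega), by simp, fun i hi => ?_⟩
  rw [Finset.mem_Icc] at hi
  constructor
  · obtain ⟨d, hd⟩ := Nat.exists_eq_add_of_le hi.1
    rw [hd]
    exact hb1.trans (bmono d 1 le_rfl (by omega))
  · obtain ⟨d, hd⟩ := Nat.exists_eq_add_of_le hi.2
    have := bmono d i hi.1 (by omega)
    rw [← hd] at this
    exact this.trans main
end
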